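/- arXiv:1506.02155 — 5 statements merged into one kernel-verified Lean document; each statement's English description precedes it below -/
import Mathlib

section
/- For every real number a > 1, the integral ∫₀¹ √(log(a/ε)) dε is at most √(log a) + 1/(2·√(log a)). -/
open MeasureTheory

/-- For every real `a > 1`, `∫₀¹ √(log (a/ε)) dε ≤ √(log a) + 1/(2 √(log a))`. -/
theorem integral_sqrt_log_le (a : ℝ) (ha : 1 < a) :
    ∫ ε in Set.Ioc (0 : ℝ) 1, Real.sqrt (Real.log (a / ε)) ≤
      Real.sqrt (Real.log a) + 1 / (2 * Real.sqrt (Real.log a)) := by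
  have hL : 0 < Real.log a := Real.log_pos ha
  have hs : 0 < Real.sqrt (Real.log a) := Real.sqrt_pos.mpr hL
  have hsq : Real.sqrt (Real.log a) ^ 2 = Real.log a := Real.sq_sqrt hL.le
  set s := Real.sqrt (Real.log a) with hsdef
  have hlog : IntervalIntegrable Real.log volume 0 1 := intervalIntegral.intervalIntegrable_log'
  have hlog2 : IntervalIntegrable (fun x => 1 / (2 * s) * Real.log x) volume 0 1 :=
    hlog.const_mul _
  have hc : IntervalIntegrable (fun _ : ℝ => s) volume 0 1 := intervalIntegrable_const
  have hg : IntegrableOn (fun x => s - 1 / (2 * s) * Real.log x) (Set.Ioc (0 : ℝ) 1) volume :=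
    (intervalIntegrable_iff_integrableOn_Ioc_of_le zero_le_one).1 (hc.sub hlog2)
  have hint : ∫ x in Set.Ioc (0 : ℝ) 1, (s - 1 / (2 * s) * Real.log x) = s + 1 / (2 * s) := by
    rw [← intervalIntegral.integral_of_le zero_le_one, intervalIntegral.integral_sub hc hlog2,
      intervalIntegral.integral_const_mul, integral_log]
    simp
  rw [← hint]
  refine integral_mono_of_nonneg (Filter.Eventually.of_forall fun x => Real.sqrt_nonneg _) hg ?_
  filter_upwards [ae_restrict_mem measurableSet_Ioc] with x hx
  have hx0 : Real.log x ≤ 0 := Real.log_nonpos hx.1.le hx.2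
  rw [Real.log_div (by positivity) hx.1.ne', ← hsq]
  have ht : 0 ≤ - (1 / (2 * s) * Real.log x) := by
    have : 0 ≤ 1 / (2 * s) * (- Real.log x) := mul_nonneg (by positivity) (by linarith)
    linarith
  apply Real.sqrt_le_iff.mpr
  refine ⟨by linarith, ?_⟩
  have h2 : 2 * s * (1 / (2 * s) * Real.log x) = Real.log x := by field_simp
  nlinarith [sq_nonneg (1 / (2 * s) * Real.log x)]
end

section
/- Fix multi-indices p, q ∈ ℕ^d with n := |p| + |q|, points ω₁,…,ω_m ∈ ℝ^d, and define g_z(ω) := ω^p·(−ω)^q·cos(⟨ω, z⟩ + nπ/2) for z, ω ∈ ℝ^d. Then for all z₁, z₂ ∈ ℝ^d, √( (1/m) Σ_{j=1}^m ( g_{z₁}(ω_j) − g_{z₂}(ω_j) )² ) ≤ ‖z₁ − z₂‖₂ · √( (1/m) Σ_{j=1}^m |ω_j^{2(p+q)}| · ‖ω_j‖₂² ). -/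
open MeasureTheory RealInnerProductSpace

/-- The function `g_z(ω) = ω^p (−ω)^q cos(⟨ω,z⟩ + nπ/2)`, `n = |p|+|q|`. -/
noncomputable def gfun (d : ℕ) (p q : Fin d → ℕ) (z ω : EuclideanSpace ℝ (Fin d)) : ℝ :=
  (∏ i, ω i ^ p i) * (∏ i, (-ω i) ^ q i) *
    Real.cos (⟪ω, z⟫ + ((∑ i, p i + ∑ i, q i : ℕ) : ℝ) * Real.pi / 2)

/-- The empirical `L²` distance between `g_{z₁}` and `g_{z₂}` is bounded by
`‖z₁ − z₂‖₂ √((1/m) Σ_j |ω_j^{2(p+q)}| ‖ω_j‖₂²)`. -/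
theorem empirical_L2_dist_gfun_le (d m : ℕ) (hm : 1 ≤ m) (p q : Fin d → ℕ)
    (ω : Fin m → EuclideanSpace ℝ (Fin d)) (z₁ z₂ : EuclideanSpace ℝ (Fin d)) :
    Real.sqrt ((1 / m) * ∑ j, (gfun d p q z₁ (ω j) - gfun d p q z₂ (ω j)) ^ 2) ≤
      ‖z₁ - z₂‖ *
        Real.sqrt ((1 / m) * ∑ j, |∏ i, (ω j) i ^ (2 * (p i + q i))| * ‖ω j‖ ^ 2) := by
  have hcos : ∀ a b : ℝ, (Real.cos a - Real.cos b) ^ 2 ≤ (a - b) ^ 2 := by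
    intro a b
    rw [Real.cos_sub_cos]
    have h1 : |Real.sin ((a + b) / 2)| ≤ 1 := Real.abs_sin_le_one _
    have h2 : |Real.sin ((a - b) / 2)| ≤ |(a - b) / 2| := Real.abs_sin_le_abs
    rw [sq_le_sq]
    rw [abs_mul, abs_mul]
    have h3 : |a - b| = 2 * |(a - b) / 2| := by
      rw [abs_div, abs_of_pos (two_pos : (0 : ℝ) < 2)]; ring
    have h4 : |(-2 : ℝ)| = 2 := by norm_num
    rw [h3, h4]
    nlinarith [abs_nonneg (Real.sin ((a + b) / 2)), abs_nonneg (Real.sin ((a - b) / 2))]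
  have key : ∀ j, (gfun d p q z₁ (ω j) - gfun d p q z₂ (ω j)) ^ 2 ≤
      ‖z₁ - z₂‖ ^ 2 * (|∏ i, (ω j) i ^ (2 * (p i + q i))| * ‖ω j‖ ^ 2) := by
    intro j
    have hP : ((∏ i, (ω j) i ^ p i) * (∏ i, (-(ω j) i) ^ q i)) ^ 2 =
        |∏ i, (ω j) i ^ (2 * (p i + q i))| := by
      have hQ : ((∏ i, (ω j) i ^ p i) * (∏ i, (-(ω j) i) ^ q i)) ^ 2 =
          ∏ i, (ω j) i ^ (2 * (p i + q i)) := by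
        rw [← Finset.prod_mul_distrib, ← Finset.prod_pow]
        refine Finset.prod_congr rfl fun i _ => ?_
        rw [mul_pow, ← pow_mul, ← pow_mul, mul_comm (q i) 2, pow_mul (-(ω j) i), neg_sq,
          ← pow_mul, ← pow_add]
        congr 1
        ring
      rw [← hQ, abs_of_nonneg (sq_nonneg _)]
    unfold gfun
    rw [← mul_sub, mul_pow, hP]
    have h1 := hcos (⟪ω j, z₁⟫ + ((∑ i, p i + ∑ i, q i : ℕ) : ℝ) * Real.pi / 2)
      (⟪ω j, z₂⟫ + ((∑ i, p i + ∑ i, q i : ℕ) : ℝ) * Real.pi / 2)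
    rw [add_sub_add_right_eq_sub, ← inner_sub_right] at h1
    have h2 : (⟪ω j, z₁ - z₂⟫) ^ 2 ≤ (‖ω j‖ * ‖z₁ - z₂‖) ^ 2 := by
      rw [sq_le_sq, abs_of_nonneg (by positivity : 0 ≤ ‖ω j‖ * ‖z₁ - z₂‖)]
      exact abs_real_inner_le_norm _ _
    calc _ ≤ |∏ i, (ω j) i ^ (2 * (p i + q i))| * (‖ω j‖ * ‖z₁ - z₂‖) ^ 2 :=
          mul_le_mul_of_nonneg_left (h1.trans h2) (abs_nonneg _)
      _ = _ := by ring
  apply Real.sqrt_le_iff.mpr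
  refine ⟨by positivity, ?_⟩
  rw [mul_pow, Real.sq_sqrt (by positivity), mul_left_comm, Finset.mul_sum _ _ (‖z₁ - z₂‖ ^ 2)]
  exact mul_le_mul_of_nonneg_left (Finset.sum_le_sum fun j _ => key j) (by positivity)
end

section
/- Fix multi-indices p, q ∈ ℕ^d with n := |p| + |q|, points ω₁,…,ω_m ∈ ℝ^d, a nonempty compact set 𝒮 ⊂ ℝ^d with diameter |𝒮|, and let 𝒮_Δ := {x − y : x, y ∈ 𝒮}. Define g_z(ω) := ω^p·(−ω)^q·cos(⟨ω, z⟩ + nπ/2) and A := √( (1/m) Σ_{j=1}^m |ω_j^{2(p+q)}|·‖ω_j‖₂² ). Then for every r > 0 there exists a finite set Z₀ ⊆ 𝒮_Δ of cardinality at most (4·|𝒮|·A/r + 1)^d such that for every z ∈ 𝒮_Δ there is z₀ ∈ Z₀ with √( (1/m) Σ_{j=1}^m ( g_z(ω_j) − g_{z₀}(ω_j) )² ) ≤ r. -/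
open MeasureTheory RealInnerProductSpace

open Metric Function in
theorem cov_card_le {d : ℕ} (s : Finset (EuclideanSpace ℝ (Fin d))) (R ε : ℝ)
    (hR : 0 ≤ R) (hε : 0 < ε) (hs : ∀ c ∈ s, ‖c‖ ≤ R)
    (h : ∀ c ∈ s, ∀ e ∈ s, c ≠ e → ε ≤ dist c e) :
    (s.card : ℝ) ≤ (2 * R / ε + 1) ^ d := by
  let E := EuclideanSpace ℝ (Fin d)
  let μ : Measure E := volume
  have δpos : 0 < ε / 2 := by positivity
  have ρpos : 0 < R + ε / 2 := by positivity
  have D : Set.Pairwise (s : Set E) (Disjoint on fun c => ball (c : E) (ε / 2)) := by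
    rintro c hc e he hce
    apply ball_disjoint_ball
    have := h c hc e he hce
    linarith
  have A_subset : (⋃ c ∈ s, ball (c : E) (ε / 2)) ⊆ ball (0 : E) (R + ε / 2) := by
    refine Set.iUnion₂_subset fun x hx => ?_
    apply ball_subset_ball'
    rw [dist_zero_right]
    have := hs x hx
    linarith
  have I : (s.card : ENNReal) * ENNReal.ofReal ((ε / 2) ^ d) * μ (ball 0 1) ≤
      ENNReal.ofReal ((R + ε / 2) ^ d) * μ (ball 0 1) :=
    calc
      (s.card : ENNReal) * ENNReal.ofReal ((ε / 2) ^ d) * μ (ball 0 1)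
          = μ (⋃ c ∈ s, ball (c : E) (ε / 2)) := by
        rw [measure_biUnion_finset D fun c _ => measurableSet_ball]
        simp only [μ.addHaar_ball_of_pos _ δpos]
        simp only [E, Finset.sum_const, nsmul_eq_mul, mul_assoc, finrank_euclideanSpace_fin]
      _ ≤ μ (ball (0 : E) (R + ε / 2)) := measure_mono A_subset
      _ = ENNReal.ofReal ((R + ε / 2) ^ d) * μ (ball 0 1) := by
        simp only [μ.addHaar_ball_of_pos _ ρpos]
        simp only [E, finrank_euclideanSpace_fin]
  have J : (s.card : ENNReal) * ENNReal.ofReal ((ε / 2) ^ d) ≤ ENNReal.ofReal ((R + ε / 2) ^ d) :=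
    (ENNReal.mul_le_mul_iff_left (measure_ball_pos _ _ zero_lt_one).ne' measure_ball_lt_top.ne).1 I
  have K := ENNReal.toReal_le_of_le_ofReal (pow_nonneg ρpos.le _) J
  rw [ENNReal.toReal_mul, ENNReal.toReal_natCast, ENNReal.toReal_ofReal (by positivity),
    ← le_div_iff₀ (by positivity), ← div_pow] at K
  refine K.trans (le_of_eq ?_)
  congr 1
  field_simp

theorem cov_net {d : ℕ} (T : Set (EuclideanSpace ℝ (Fin d))) (R ε : ℝ)
    (hR : 0 ≤ R) (hε : 0 < ε) (hT : ∀ c ∈ T, ‖c‖ ≤ R) :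
    ∃ Z : Finset (EuclideanSpace ℝ (Fin d)), ↑Z ⊆ T ∧ (Z.card : ℝ) ≤ (2 * R / ε + 1) ^ d ∧
      ∀ z ∈ T, ∃ z₀ ∈ Z, dist z z₀ ≤ ε := by
  classical
  let P : Finset (EuclideanSpace ℝ (Fin d)) → Prop := fun Z =>
    ↑Z ⊆ T ∧ ∀ c ∈ Z, ∀ e ∈ Z, c ≠ e → ε ≤ dist c e
  have hP : ∀ Z, P Z → (Z.card : ℝ) ≤ (2 * R / ε + 1) ^ d := fun Z hZ =>
    cov_card_le Z R ε hR hε (fun c hc => hT c (hZ.1 hc)) hZ.2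
  let C : Set ℕ := {k | ∃ Z, P Z ∧ Z.card = k}
  have hne : C.Nonempty := ⟨0, ∅, by simp [P], by simp⟩
  have hb : BddAbove C := by
    refine ⟨⌊(2 * R / ε + 1) ^ d⌋₊, ?_⟩
    rintro k ⟨Z, hZ, rfl⟩
    exact Nat.le_floor (hP Z hZ)
  obtain ⟨Z, hZ, hk⟩ := Nat.sSup_mem hne hb
  refine ⟨Z, hZ.1, hP Z hZ, fun z hz => ?_⟩
  by_contra! hcon
  have hzZ : z ∉ Z := fun hmem => by
    have := hcon z hmem
    rw [dist_self] at this
    linarith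
  have hI : P (insert z Z) := by
    refine ⟨?_, ?_⟩
    · rw [Finset.coe_insert]
      exact Set.insert_subset hz hZ.1
    · intro c hc e he hce
      rw [Finset.mem_insert] at hc he
      rcases hc with rfl | hc <;> rcases he with rfl | he
      · exact absurd rfl hce
      · exact (hcon e he).le
      · rw [dist_comm]; exact (hcon c hc).le
      · exact hZ.2 c hc e he hce
  have := le_csSup hb (show (insert z Z).card ∈ C from ⟨_, hI, rfl⟩)
  rw [Finset.card_insert_of_notMem hzZ] at this
  omega

theorem gfun_lip (d : ℕ) (p q : Fin d → ℕ) (z z₀ ω : EuclideanSpace ℝ (Fin d)) :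
    (gfun d p q z ω - gfun d p q z₀ ω) ^ 2 ≤
      (|∏ i, ω i ^ (2 * (p i + q i))| * ‖ω‖ ^ 2) * dist z z₀ ^ 2 := by
  unfold gfun
  rw [← mul_sub, mul_pow]
  have h1 : ((∏ i, ω i ^ p i) * (∏ i, (-ω i) ^ q i)) ^ 2 = |∏ i, ω i ^ (2 * (p i + q i))| := by
    rw [abs_of_nonneg (Finset.prod_nonneg fun i _ => by rw [pow_mul]; positivity),
      ← Finset.prod_mul_distrib, ← Finset.prod_pow]
    refine Finset.prod_congr rfl fun i _ => ?_
    rw [mul_pow, ← pow_mul, ← pow_mul, mul_comm (q i) 2, pow_mul (-ω i), neg_sq]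
    ring
  rw [h1, mul_assoc]
  refine mul_le_mul_of_nonneg_left ?_ (abs_nonneg _)
  rw [← mul_pow, ← sq_abs]
  refine pow_le_pow_left₀ (abs_nonneg _) ?_ 2
  refine (Real.abs_cos_sub_cos_le _ _).trans ?_
  rw [add_sub_add_right_eq_sub, ← inner_sub_right, dist_eq_norm]
  exact abs_real_inner_le_norm _ _

/-- Covering-number bound for the family `{g_z : z ∈ 𝒮_Δ}` in the empirical `L²` metric:
for every `r > 0` there is an `r`-net of cardinality at most `(4|𝒮|A/r + 1)^d`. -/
theorem covering_gfun_empirical_L2 (d m : ℕ) (hm : 1 ≤ m) (p q : Fin d → ℕ)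
    (ω : Fin m → EuclideanSpace ℝ (Fin d))
    (S : Set (EuclideanSpace ℝ (Fin d))) (hS : IsCompact S) (hSne : S.Nonempty)
    (r : ℝ) (hr : 0 < r) :
    ∃ Z : Finset (EuclideanSpace ℝ (Fin d)),
      ↑Z ⊆ {z : EuclideanSpace ℝ (Fin d) | ∃ x ∈ S, ∃ y ∈ S, z = x - y} ∧
      (Z.card : ℝ) ≤
        (4 * Metric.diam S *
            Real.sqrt ((1 / m) * ∑ j, |∏ i, (ω j) i ^ (2 * (p i + q i))| * ‖ω j‖ ^ 2) / r
          + 1) ^ d ∧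
      ∀ z ∈ {z : EuclideanSpace ℝ (Fin d) | ∃ x ∈ S, ∃ y ∈ S, z = x - y},
        ∃ z₀ ∈ Z,
          Real.sqrt ((1 / m) * ∑ j, (gfun d p q z (ω j) - gfun d p q z₀ (ω j)) ^ 2) ≤ r := by
  set B : ℝ := (1 / m) * ∑ j, |∏ i, (ω j) i ^ (2 * (p i + q i))| * ‖ω j‖ ^ 2 with hB
  have hdiam : 0 ≤ Metric.diam S := Metric.diam_nonneg
  have key : ∀ z z₀, Real.sqrt ((1 / m) * ∑ j, (gfun d p q z (ω j) - gfun d p q z₀ (ω j)) ^ 2)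
      ≤ Real.sqrt B * dist z z₀ := by
    intro z z₀
    rw [← Real.sqrt_sq (dist_nonneg (x := z) (y := z₀)), ← Real.sqrt_mul' _ (sq_nonneg _)]
    apply Real.sqrt_le_sqrt
    rw [hB, mul_assoc, Finset.sum_mul]
    refine mul_le_mul_of_nonneg_left ?_ (by positivity)
    exact Finset.sum_le_sum fun j _ => gfun_lip d p q z z₀ (ω j)
  rcases (Real.sqrt_nonneg B).eq_or_lt with h0 | hpos
  · obtain ⟨x, hx⟩ := hSne
    refine ⟨{x - x}, ?_, ?_, ?_⟩
    · simp only [Finset.coe_singleton, Set.singleton_subset_iff]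
      exact ⟨x, hx, x, hx, rfl⟩
    · rw [← h0]; simp
    · intro z _
      refine ⟨x - x, by simp, (key _ _).trans ?_⟩
      rw [← h0, zero_mul]; exact hr.le
  · obtain ⟨Z, h1, h2, h3⟩ := cov_net
      {z : EuclideanSpace ℝ (Fin d) | ∃ x ∈ S, ∃ y ∈ S, z = x - y}
      (Metric.diam S) (r / Real.sqrt B) hdiam (by positivity) (by
        rintro c ⟨x, hx, y, hy, rfl⟩
        rw [← dist_eq_norm]
        exact Metric.dist_le_diam_of_mem hS.isBounded hx hy)
    refine ⟨Z, h1, h2.trans ?_, fun z hz => ?_⟩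
    · refine pow_le_pow_left₀ (by positivity) ?_ d
      rw [div_div_eq_mul_div]
      gcongr
      norm_num
    · obtain ⟨z₀, hz₀, hd⟩ := h3 z hz
      refine ⟨z₀, hz₀, (key _ _).trans ?_⟩
      rw [le_div_iff₀ hpos] at hd
      linarith
end

section
/- Let Λ be a Borel probability measure on ℝ^d, let k(x, y) := ∫_{ℝ^d} cos(⟨ω, x − y⟩) dΛ(ω), let ω₁,…,ω_m be i.i.d. with law Λ, and let k̂(x, y) := (1/m) Σ_{j=1}^m cos(⟨ω_j, x − y⟩). Let 𝒮 ⊂ ℝ^d be a compact set of Lebesgue measure vol(𝒮) and r ∈ [1, ∞). Then for every τ > 0, with probability at least 1 − e^{−τ} over the sample (ω_j)_{j=1}^m, ‖k − k̂‖_{L^r(𝒮×𝒮)} ≤ E[ ‖k − k̂‖_{L^r(𝒮×𝒮)} ] + vol(𝒮)^{2/r}·√(2τ/m). -/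
open MeasureTheory RealInnerProductSpace

/-- The `L^r` norm on `𝒮 × 𝒮` (w.r.t. Lebesgue measure) of a real function. -/
noncomputable def lrnorm (d : ℕ) (S : Set (EuclideanSpace ℝ (Fin d))) (r : ℝ)
    (f : EuclideanSpace ℝ (Fin d) × EuclideanSpace ℝ (Fin d) → ℝ) : ℝ :=
  (∫ z in S ×ˢ S, |f z| ^ r) ^ (1 / r)

lemma mcd_cons_measurable {Ω : Type*} [MeasurableSpace Ω] (n : ℕ) :
    Measurable (fun p : Ω × (Fin n → Ω) => (Fin.cons p.1 p.2 : Fin (n + 1) → Ω)) := by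
  rw [measurable_pi_iff]
  intro i
  refine Fin.cases ?_ (fun j => ?_) i
  · simpa using measurable_fst
  · exact (measurable_pi_apply j).comp measurable_snd

lemma mcd_fubini {Ω : Type*} [MeasurableSpace Ω] (μ : Measure Ω) [IsProbabilityMeasure μ]
    (n : ℕ) (F : (Fin (n + 1) → Ω) → ℝ) (hF : Measurable F) (B : ℝ) (hB : ∀ w, |F w| ≤ B) :
    ∫ w, F w ∂(Measure.pi fun _ : Fin (n + 1) => μ) =
      ∫ w, ∫ x, F (Fin.cons x w) ∂μ ∂(Measure.pi fun _ : Fin n => μ) := by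
  have h := (measurePreserving_piFinSuccAbove (fun _ : Fin (n + 1) => μ) 0).symm
  rw [← h.integral_comp' F]
  have hi : ∀ p : Ω × (Fin n → Ω),
      (MeasurableEquiv.piFinSuccAbove (fun _ : Fin (n + 1) => Ω) 0).symm p =
        (Fin.cons p.1 p.2 : Fin (n + 1) → Ω) := by
    intro p
    simp [MeasurableEquiv.piFinSuccAbove]
    rfl
  simp_rw [hi]
  rw [integral_prod_symm]
  refine Integrable.of_bound (hF.comp (mcd_cons_measurable n)).aestronglyMeasurable B ?_
  exact Filter.Eventually.of_forall fun p => hB _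

lemma mcd_mgf {Ω : Type*} [MeasurableSpace Ω] (μ : Measure Ω) [IsProbabilityMeasure μ]
    (c B t : ℝ) (n : ℕ) : ∀ g : (Fin n → Ω) → ℝ, Measurable g → (∀ w, |g w| ≤ B) →
    (∀ w i x, g (Function.update w i x) ≤ g w + c) →
    ∫ w, Real.exp (t * (g w - ∫ w', g w' ∂(Measure.pi fun _ : Fin n => μ)))
      ∂(Measure.pi fun _ : Fin n => μ) ≤ Real.exp (n * ((c / 2) ^ 2 * t ^ 2 / 2)) := by
  induction n with
  | zero =>
    intro g hg hB hc
    have : ∀ w : Fin 0 → Ω, g w = g default := fun w => by rw [Subsingleton.elim w default]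
    simp [this]
  | succ n ih =>
    intro g hg hB hc
    have hne : Nonempty Ω := μ.nonempty_of_neZero
    set P := Measure.pi fun _ : Fin n => μ with hP
    set G : (Fin n → Ω) → ℝ := fun w => ∫ x, g (Fin.cons x w) ∂μ with hG
    have hgc := hg.comp (mcd_cons_measurable (Ω := Ω) n)
    have hGm : Measurable G :=
      (hgc.stronglyMeasurable.integral_prod_left' (μ := μ)).measurable
    have hgx : ∀ w, Measurable fun x => g (Fin.cons x w : Fin (n + 1) → Ω) := fun w =>
      hgc.comp (measurable_id.prodMk measurable_const)
    have hgi : ∀ w, Integrable (fun x => g (Fin.cons x w : Fin (n + 1) → Ω)) μ := fun w =>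
      Integrable.of_bound (hgx w).aestronglyMeasurable B
        (Filter.Eventually.of_forall fun p => hB _)
    have hGB : ∀ w, |G w| ≤ B := fun w => by
      have := norm_integral_le_of_norm_le_const (μ := μ) (C := B)
        (f := fun x => g (Fin.cons x w : Fin (n + 1) → Ω))
        (Filter.Eventually.of_forall fun p => hB _)
      simpa using this
    have hGc : ∀ w i x, G (Function.update w i x) ≤ G w + c := by
      intro w i x
      have h2 : G w + c = ∫ y, (g (Fin.cons y w : Fin (n + 1) → Ω) + c) ∂μ := by
        rw [integral_add (hgi w) (integrable_const _)]; simp [hG]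
      rw [h2]
      refine integral_mono (hgi _) ((hgi w).add (integrable_const _)) fun y => ?_
      simp only [Fin.cons_update]
      exact hc _ _ _
    have hE : ∫ w', g w' ∂(Measure.pi fun _ : Fin (n + 1) => μ) = ∫ w, G w ∂P :=
      mcd_fubini μ n g hg B hB
    rw [hE]
    set E := ∫ w, G w ∂P with hEdef
    have hbd : ∀ y : ℝ, |y| ≤ B → |Real.exp (t * (y - E))| ≤ Real.exp (|t| * (B + |E|)) := by
      intro y hy
      rw [Real.abs_exp, Real.exp_le_exp]
      calc t * (y - E) ≤ |t * (y - E)| := le_abs_self _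
        _ = |t| * |y - E| := abs_mul _ _
        _ ≤ _ := by
          gcongr
          exact (abs_sub _ _).trans (by gcongr)
    rw [mcd_fubini μ n (fun w => Real.exp (t * (g w - E))) (by fun_prop) _ (fun w => hbd _ (hB w))]
    have hinner : ∀ w, ∫ x, Real.exp (t * (g (Fin.cons x w : Fin (n + 1) → Ω) - E)) ∂μ ≤
        Real.exp ((c / 2) ^ 2 * t ^ 2 / 2) * Real.exp (t * (G w - E)) := by
      intro w
      set a := ⨅ x, g (Fin.cons x w : Fin (n + 1) → Ω) with ha
      have hbb : BddBelow (Set.range fun x => g (Fin.cons x w : Fin (n + 1) → Ω)) :=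
        ⟨-B, by rintro _ ⟨x, rfl⟩; exact (abs_le.1 (hB _)).1⟩
      have hmem : ∀ x, g (Fin.cons x w : Fin (n + 1) → Ω) ∈ Set.Icc a (a + c) := by
        intro x
        refine ⟨ciInf_le hbb x, ?_⟩
        rw [← sub_le_iff_le_add]
        refine le_ciInf fun y => ?_
        have := hc (Fin.cons y w) 0 x
        rw [Fin.update_cons_zero] at this
        linarith
      have hs := (ProbabilityTheory.hasSubgaussianMGF_of_mem_Icc (μ := μ) (hgx w).aemeasurable
        (Filter.Eventually.of_forall hmem)).mgf_le t
      have hk : ((‖a + c - a‖₊ / 2) ^ 2 : NNReal) = (c / 2) ^ 2 := by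
        push_cast
        simp [div_pow]
      rw [hk] at hs
      have h3 : ∀ x, Real.exp (t * (g (Fin.cons x w : Fin (n + 1) → Ω) - E)) =
          Real.exp (t * (g (Fin.cons x w : Fin (n + 1) → Ω) - G w)) *
            Real.exp (t * (G w - E)) := by
        intro x
        rw [← Real.exp_add]; ring_nf
      simp_rw [h3]
      rw [integral_mul_const]
      exact mul_le_mul_of_nonneg_right hs (Real.exp_pos _).le
    have hm2 : Measurable fun w => ∫ x, Real.exp (t * (g (Fin.cons x w : Fin (n + 1) → Ω) - E)) ∂μ := by
      have : Measurable (fun p : Ω × (Fin n → Ω) =>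
        Real.exp (t * (g (Fin.cons p.1 p.2 : Fin (n + 1) → Ω) - E))) :=
        ((hgc.sub_const E).const_mul t).exp
      exact (this.stronglyMeasurable.integral_prod_left' (μ := μ)).measurable
    have hi2 : Integrable (fun w => Real.exp (t * (G w - E))) P :=
      Integrable.of_bound (by fun_prop) _ (Filter.Eventually.of_forall fun w => hbd _ (hGB w))
    calc _ ≤ ∫ w, Real.exp ((c / 2) ^ 2 * t ^ 2 / 2) * Real.exp (t * (G w - E)) ∂P := by
          refine integral_mono_of_nonneg (Filter.Eventually.of_forall fun w => ?_)
            (hi2.const_mul _) (Filter.Eventually.of_forall hinner)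
          exact integral_nonneg fun x => (Real.exp_pos _).le
      _ = Real.exp ((c / 2) ^ 2 * t ^ 2 / 2) * ∫ w, Real.exp (t * (G w - E)) ∂P :=
          integral_const_mul _ _
      _ ≤ Real.exp ((c / 2) ^ 2 * t ^ 2 / 2) * Real.exp (n * ((c / 2) ^ 2 * t ^ 2 / 2)) := by
          gcongr
          exact ih G hGm hGB hGc
      _ = _ := by
          rw [← Real.exp_add]; congr 1; push_cast; ring

lemma mcd_tail {Ω : Type*} [MeasurableSpace Ω] (μ : Measure Ω) [IsProbabilityMeasure μ]
    (n : ℕ) (hn : 1 ≤ n) (V B τ : ℝ) (hV : 0 < V) (hτ : 0 < τ) (g : (Fin n → Ω) → ℝ)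
    (hg : Measurable g) (hB : ∀ w, |g w| ≤ B)
    (hc : ∀ w i x, g (Function.update w i x) ≤ g w + 2 * V / n) :
    1 - ENNReal.ofReal (Real.exp (-τ)) ≤ (Measure.pi fun _ : Fin n => μ)
      {w | g w ≤ (∫ w', g w' ∂(Measure.pi fun _ : Fin n => μ)) + V * Real.sqrt (2 * τ / n)} := by
  set P := Measure.pi fun _ : Fin n => μ with hP
  set E := ∫ w', g w' ∂P with hE
  have hn0 : (0 : ℝ) < n := by exact_mod_cast hn
  set s := Real.sqrt (2 * τ / n) with hs
  have hs2 : s ^ 2 = 2 * τ / n := Real.sq_sqrt (by positivity)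
  have hs0 : 0 < s := Real.sqrt_pos.2 (by positivity)
  set t := n * s / V with ht
  have hi : Integrable (fun w => Real.exp (t * (g w - E))) P := by
    refine Integrable.of_bound (by fun_prop) (Real.exp (|t| * (B + |E|)))
      (Filter.Eventually.of_forall fun w => ?_)
    rw [Real.norm_eq_abs, Real.abs_exp, Real.exp_le_exp]
    calc t * (g w - E) ≤ |t * (g w - E)| := le_abs_self _
        _ = |t| * |g w - E| := abs_mul _ _
        _ ≤ _ := by
          gcongr
          exact (abs_sub _ _).trans (by gcongr; exact hB w)
  have h1 := ProbabilityTheory.measure_ge_le_exp_mul_mgf (μ := P) (X := fun w => g w - E) (V * s)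
    (t := t) (by positivity) hi
  have h2 := mcd_mgf μ (2 * V / n) B t n g hg hB hc
  have h3 : P.real {w | V * s ≤ g w - E} ≤ Real.exp (-τ) := by
    refine h1.trans ((mul_le_mul_of_nonneg_left h2 (Real.exp_pos _).le).trans ?_)
    rw [← Real.exp_add, Real.exp_le_exp]
    apply le_of_eq
    have e1 : -t * (V * s) = - (n * s ^ 2) := by rw [ht]; field_simp
    have e2 : n * ((2 * V / n / 2) ^ 2 * t ^ 2 / 2) = n * s ^ 2 / 2 := by rw [ht]; field_simp
    rw [e1, e2, hs2]
    field_simp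
    ring
  have hm : MeasurableSet {w | g w ≤ E + V * s} := measurableSet_le hg measurable_const
  have h4 : P {w | g w ≤ E + V * s}ᶜ ≤ ENNReal.ofReal (Real.exp (-τ)) := by
    refine (measure_mono (t := {w | V * s ≤ g w - E}) ?_).trans ?_
    · intro w hw
      simp only [Set.mem_compl_iff, Set.mem_ofPred_eq, not_le] at hw ⊢
      linarith
    · rw [← ENNReal.ofReal_toReal (measure_ne_top P _)]
      exact ENNReal.ofReal_le_ofReal h3
  rw [tsub_le_iff_right]
  calc (1 : ENNReal) = P {w | g w ≤ E + V * s} + P {w | g w ≤ E + V * s}ᶜ := by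
        rw [measure_add_measure_compl hm, measure_univ]
    _ ≤ _ := by gcongr

lemma lrnorm_eq {d : ℕ} {S : Set (EuclideanSpace ℝ (Fin d))} {r : ℝ} (hr : 1 ≤ r)
    {f : EuclideanSpace ℝ (Fin d) × EuclideanSpace ℝ (Fin d) → ℝ} (hf : Measurable f) :
    lrnorm d S r f = lpNorm f (ENNReal.ofReal r) (volume.restrict (S ×ˢ S)) := by
  have h0 : 0 < r := by linarith
  rw [lpNorm_eq_integral_norm_rpow_toReal (by simpa using h0) (by simp) hf.aestronglyMeasurable,
    ENNReal.toReal_ofReal h0.le]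
  simp [lrnorm]

lemma lrnorm_le_const {d : ℕ} {S : Set (EuclideanSpace ℝ (Fin d))} (hS : IsCompact S)
    {r : ℝ} (hr : 1 ≤ r)
    {f : EuclideanSpace ℝ (Fin d) × EuclideanSpace ℝ (Fin d) → ℝ} {C : ℝ} (hC : 0 ≤ C)
    (hb : ∀ z, |f z| ≤ C) :
    lrnorm d S r f ≤ C * (volume S).toReal ^ (2 / r) := by
  have h0 : 0 < r := by linarith
  have hfin : volume (S ×ˢ S) < ⊤ := (hS.prod hS).measure_lt_top
  have hvol : volume.real (S ×ˢ S) = (volume S).toReal ^ (2 : ℝ) := by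
    rw [measureReal_def, Measure.volume_eq_prod, Measure.prod_prod, ENNReal.toReal_mul]
    norm_cast
    ring
  have h1 : ∫ z in S ×ˢ S, |f z| ^ r ≤ C ^ r * (volume S).toReal ^ (2 : ℝ) := by
    have := norm_setIntegral_le_of_norm_le_const (f := fun z => |f z| ^ r) (C := C ^ r) hfin
      (fun z _ => by
        rw [Real.norm_eq_abs, abs_of_nonneg (by positivity)]
        exact Real.rpow_le_rpow (abs_nonneg _) (hb z) h0.le)
    rw [hvol] at this
    exact (le_abs_self _).trans this
  have h2 : 0 ≤ ∫ z in S ×ˢ S, |f z| ^ r := integral_nonneg fun z => by positivity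
  refine (Real.rpow_le_rpow h2 h1 (by positivity)).trans ?_
  rw [Real.mul_rpow (by positivity) (by positivity), ← Real.rpow_mul hC,
    ← Real.rpow_mul ENNReal.toReal_nonneg]
  apply le_of_eq
  congr 2
  · rw [mul_one_div_cancel h0.ne', Real.rpow_one]
  · ring

lemma lrnorm_nonneg {d : ℕ} {S : Set (EuclideanSpace ℝ (Fin d))} {r : ℝ}
    {f : EuclideanSpace ℝ (Fin d) × EuclideanSpace ℝ (Fin d) → ℝ} : 0 ≤ lrnorm d S r f :=
  Real.rpow_nonneg (integral_nonneg fun z => by positivity) _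

lemma lrnorm_tri {d : ℕ} {S : Set (EuclideanSpace ℝ (Fin d))} (hS : IsCompact S)
    {r : ℝ} (hr : 1 ≤ r)
    {f g : EuclideanSpace ℝ (Fin d) × EuclideanSpace ℝ (Fin d) → ℝ} (hf : Measurable f)
    (hg : Measurable g) {C D : ℝ} (hC : 0 ≤ C)
    (hD : ∀ z, |g z| ≤ D) (hb : ∀ z, |f z - g z| ≤ C) :
    lrnorm d S r f ≤ lrnorm d S r g + C * (volume S).toReal ^ (2 / r) := by
  have hfin : volume (S ×ˢ S) < ⊤ := (hS.prod hS).measure_lt_top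
  have : IsFiniteMeasure
      ((volume : Measure (EuclideanSpace ℝ (Fin d) × EuclideanSpace ℝ (Fin d))).restrict (S ×ˢ S)) :=
    ⟨by simpa using hfin⟩
  refine le_trans ?_ (add_le_add le_rfl (lrnorm_le_const hS hr hC hb))
  change _ ≤ _ + lrnorm d S r (f - g)
  rw [lrnorm_eq hr hf, lrnorm_eq hr hg, lrnorm_eq hr (hf.sub hg)]
  have hgm : MemLp g (ENNReal.ofReal r) (volume.restrict (S ×ˢ S)) :=
    MemLp.of_bound hg.aestronglyMeasurable D (Filter.Eventually.of_forall hD)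
  have := lpNorm_add_le hgm (g := f - g) (by simpa using hr)
  simpa using this

lemma conc_aux (d m : ℕ) (hm : 1 ≤ m)
    (Λ : Measure (EuclideanSpace ℝ (Fin d))) [IsProbabilityMeasure Λ]
    (S : Set (EuclideanSpace ℝ (Fin d))) (hS : IsCompact S)
    (r : ℝ) (hr : 1 ≤ r) (τ : ℝ) (hτ : 0 < τ) (V : ℝ) (hVdef : V = (volume S).toReal ^ (2 / r))
    (K : EuclideanSpace ℝ (Fin d) × EuclideanSpace ℝ (Fin d) → ℝ) (hKm : Measurable K)
    (hK1 : ∀ z, |K z| ≤ 1)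
    (f : (Fin m → EuclideanSpace ℝ (Fin d)) →
      EuclideanSpace ℝ (Fin d) × EuclideanSpace ℝ (Fin d) → ℝ)
    (hf : f = fun w z => K z - (1 / m) * ∑ j, Real.cos ⟪w j, z.1 - z.2⟫) :
    1 - ENNReal.ofReal (Real.exp (-τ)) ≤ Measure.pi (fun _ : Fin m => Λ)
    {w | lrnorm d S r (f w) ≤ (∫ w', lrnorm d S r (f w') ∂(Measure.pi fun _ : Fin m => Λ)) +
      V * Real.sqrt (2 * τ / m)} := by
  have hm0 : (0 : ℝ) < m := by exact_mod_cast hm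
  have hV0 : 0 ≤ V := by
    rw [hVdef]
    exact Real.rpow_nonneg ENNReal.toReal_nonneg _
  have hcont : Continuous fun p : (Fin m → EuclideanSpace ℝ (Fin d)) ×
      (EuclideanSpace ℝ (Fin d) × EuclideanSpace ℝ (Fin d)) =>
      (1 / m : ℝ) * ∑ j, Real.cos ⟪p.1 j, p.2.1 - p.2.2⟫ := by fun_prop
  have hfm : Measurable (Function.uncurry f) := by
    rw [hf]
    exact (hKm.comp measurable_snd).sub hcont.measurable
  have hfw : ∀ w, Measurable (f w) := fun w => hfm.comp (measurable_const.prodMk measurable_id)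
  have hf2 : ∀ w z, |f w z| ≤ 2 := by
    intro w z
    have h1 : |(1 / m : ℝ) * ∑ j, Real.cos ⟪w j, z.1 - z.2⟫| ≤ 1 := by
      rw [abs_mul, abs_of_pos (by positivity : (0 : ℝ) < 1 / m)]
      have : |∑ j, Real.cos ⟪w j, z.1 - z.2⟫| ≤ m :=
        (Finset.abs_sum_le_sum_abs _ _).trans
          ((Finset.sum_le_sum fun j _ => Real.abs_cos_le_one _).trans (by simp))
      rw [one_div, inv_mul_le_iff₀ hm0]
      simpa using this
    rw [hf]
    calc _ ≤ |K z| + _ := abs_sub _ _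
      _ ≤ 1 + 1 := add_le_add (hK1 z) h1
      _ = 2 := by norm_num
  have hgB : ∀ w, |lrnorm d S r (f w)| ≤ 2 * V := fun w => by
    rw [abs_of_nonneg lrnorm_nonneg]
    rw [hVdef]
    exact lrnorm_le_const hS hr (by norm_num) (hf2 w)
  rcases hV0.eq_or_lt with hV | hV
  · have hz : ∀ w, lrnorm d S r (f w) = 0 := fun w => by
      have := hgB w
      rw [← hV, mul_zero] at this
      exact abs_eq_zero.1 (le_antisymm this (abs_nonneg _))
    simp [hz, ← hV]
  · refine mcd_tail Λ m hm V (2 * V) τ hV hτ (fun w => lrnorm d S r (f w)) ?_ hgB ?_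
    · have h1 : Measurable (fun p : (Fin m → EuclideanSpace ℝ (Fin d)) ×
          (EuclideanSpace ℝ (Fin d) × EuclideanSpace ℝ (Fin d)) =>
          |Function.uncurry f p| ^ r) := by
        simpa only [Real.norm_eq_abs] using hfm.norm.pow_const r
      exact (h1.stronglyMeasurable.integral_prod_right'
        (ν := volume.restrict (S ×ˢ S))).measurable.pow_const (1 / r)
    · intro w i x
      have := lrnorm_tri hS hr (hfw (Function.update w i x)) (hfw w) (C := 2 / m) (by positivity)
        (hf2 w) ?_
      · refine this.trans_eq ?_
        rw [← hVdef]; ring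
      · intro z
        have h1 : f (Function.update w i x) z - f w z =
            (1 / m) * (Real.cos ⟪w i, z.1 - z.2⟫ - Real.cos ⟪x, z.1 - z.2⟫) := by
          have : ∑ j, Real.cos ⟪w j, z.1 - z.2⟫ -
              ∑ j, Real.cos ⟪Function.update w i x j, z.1 - z.2⟫ =
              Real.cos ⟪w i, z.1 - z.2⟫ - Real.cos ⟪x, z.1 - z.2⟫ := by
            rw [← Finset.sum_sub_distrib, Finset.sum_eq_single i]
            · simp
            · intro j _ hj
              simp [Function.update_of_ne hj]
            · simp
          rw [← this]
          simp only [hf]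
          ring
        rw [h1, abs_mul, abs_of_pos (by positivity : (0 : ℝ) < 1 / m)]
        have h2 : |Real.cos ⟪w i, z.1 - z.2⟫ - Real.cos ⟪x, z.1 - z.2⟫| ≤ 2 :=
          (abs_sub _ _).trans ((add_le_add (Real.abs_cos_le_one _) (Real.abs_cos_le_one _)).trans
            (by norm_num))
        calc _ ≤ 1 / (m : ℝ) * 2 := by gcongr
          _ = 2 / m := by ring

/-- Concentration of `‖k − k̂‖_{L^r(𝒮×𝒮)}` around its mean, via McDiarmid's inequality. -/
theorem lr_norm_kernel_diff_concentration (d m : ℕ) (hm : 1 ≤ m)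
    (Λ : Measure (EuclideanSpace ℝ (Fin d))) [IsProbabilityMeasure Λ]
    (S : Set (EuclideanSpace ℝ (Fin d))) (hS : IsCompact S)
    (r : ℝ) (hr : 1 ≤ r) (τ : ℝ) (hτ : 0 < τ) :
    1 - ENNReal.ofReal (Real.exp (-τ)) ≤
      Measure.pi (fun _ : Fin m => Λ)
        {w | lrnorm d S r (fun z =>
              (∫ ω, Real.cos ⟪ω, z.1 - z.2⟫ ∂Λ) -
                (1 / m) * ∑ j, Real.cos ⟪w j, z.1 - z.2⟫) ≤
          (∫ w', lrnorm d S r (fun z =>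
              (∫ ω, Real.cos ⟪ω, z.1 - z.2⟫ ∂Λ) -
                (1 / m) * ∑ j, Real.cos ⟪w' j, z.1 - z.2⟫)
            ∂(Measure.pi fun _ : Fin m => Λ)) +
          (volume S).toReal ^ (2 / r) * Real.sqrt (2 * τ / m)} := by
  have hKm : Measurable (fun z : EuclideanSpace ℝ (Fin d) × EuclideanSpace ℝ (Fin d) =>
      ∫ ω, Real.cos ⟪ω, z.1 - z.2⟫ ∂Λ) := by
    have : StronglyMeasurable (fun p : (EuclideanSpace ℝ (Fin d) × EuclideanSpace ℝ (Fin d)) ×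
        EuclideanSpace ℝ (Fin d) => Real.cos ⟪p.2, p.1.1 - p.1.2⟫) :=
      Continuous.stronglyMeasurable (by fun_prop)
    exact this.integral_prod_right'.measurable
  have hK1 : ∀ z : EuclideanSpace ℝ (Fin d) × EuclideanSpace ℝ (Fin d),
      |∫ ω, Real.cos ⟪ω, z.1 - z.2⟫ ∂Λ| ≤ 1 := fun z => by
    have := norm_integral_le_of_norm_le_const (μ := Λ) (C := 1)
      (f := fun ω => Real.cos ⟪ω, z.1 - z.2⟫)
      (Filter.Eventually.of_forall fun p => Real.abs_cos_le_one _)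
    simpa using this
  exact conc_aux d m hm Λ S hS r hr τ hτ _ rfl _ hKm hK1 _ rfl
end

section
/- Let Λ be a Borel probability measure on ℝ^d with σ² := ∫_{ℝ^d} ‖ω‖₂² dΛ(ω) < ∞, let k(x, y) := ∫_{ℝ^d} cos(⟨ω, x − y⟩) dΛ(ω), let ω₁,…,ω_m be i.i.d. with law Λ, and let k̂(x, y) := (1/m) Σ_{j=1}^m cos(⟨ω_j, x − y⟩). Let 𝒮 ⊂ ℝ^d be a compact set with diameter |𝒮| > 0. Then for every τ > 0, with probability at least 1 − e^{−τ} over the sample (ω_j)_{j=1}^m, sup_{x, y ∈ 𝒮} |k(x, y) − k̂(x, y)| ≤ (32·√(2d)/√m)·( √(log(2|𝒮| + 1)) + 1/(2·√(log(2|𝒮| + 1))) + √(log(σ + 1)) ) + √(2τ/m). -/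
open MeasureTheory RealInnerProductSpace

lemma exp_aux (x : ℝ) : Real.exp (x - x^2/6) ≤ 1 + x + x^2/3 := by
  have hpos : ∀ y : ℝ, 0 < 1 + y + y^2/3 := fun y => by nlinarith [sq_nonneg (y + 3/2)]
  let g : ℝ → ℝ := fun y => Real.log (1 + y + y^2/3) - y + y^2/6
  have hd : ∀ y, HasDerivAt g (y^3/9 / (1 + y + y^2/3)) y := by
    intro y
    have h1 : HasDerivAt (fun y : ℝ => 1 + y + y^2/3) (1 + 2*y/3) y := by
      have := ((hasDerivAt_id y).const_add 1).add (((hasDerivAt_id y).pow 2).div_const 3)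
      refine HasDerivAt.congr_deriv this ?_
      simp
    have h2 := ((h1.log (hpos y).ne').sub (hasDerivAt_id y)).add (((hasDerivAt_id y).pow 2).div_const 6)
    refine HasDerivAt.congr_deriv h2 ?_
    have := (hpos y).ne'
    simp only [id, Nat.cast_ofNat]
    rw [eq_div_iff this, add_mul, sub_mul, div_mul_cancel₀ _ this]
    ring
  have hcont : Continuous g := continuous_iff_continuousAt.2 fun y => (hd y).continuousAt
  have h0 : g 0 = 0 := by simp [g]
  have hg : 0 ≤ g x := by
    rcases le_total 0 x with hx | hx
    · have : MonotoneOn g (Set.Ici 0) := by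
        apply monotoneOn_of_deriv_nonneg (convex_Ici 0) hcont.continuousOn
        · exact fun y _ => (hd y).differentiableAt.differentiableWithinAt
        · intro y hy
          rw [interior_Ici, Set.mem_Ioi] at hy
          rw [(hd y).deriv]
          have := hpos y
          positivity
      have := this (Set.mem_Ici.2 le_rfl) (Set.mem_Ici.2 hx) hx
      linarith
    · have : AntitoneOn g (Set.Iic 0) := by
        apply antitoneOn_of_deriv_nonpos (convex_Iic 0) hcont.continuousOn
        · exact fun y _ => (hd y).differentiableAt.differentiableWithinAt
        · intro y hy
          rw [interior_Iic, Set.mem_Iio] at hy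
          rw [(hd y).deriv]
          have := hpos y
          apply div_nonpos_of_nonpos_of_nonneg _ this.le
          have : 0 < (-y)^3 := by apply pow_pos; linarith
          nlinarith
      have := this (Set.mem_Iic.2 hx) (Set.mem_Iic.2 le_rfl) hx
      linarith
  rw [← Real.exp_log (hpos x)]
  apply Real.exp_le_exp.2
  simp only [g] at hg
  linarith

lemma net_aux (d : ℕ) (R δ : ℝ) (hR : 0 ≤ R) (hδ : 0 < δ) :
    ∃ T : Finset (EuclideanSpace ℝ (Fin d)),
      (∀ t ∈ T, ‖t‖ ≤ R) ∧ (∀ z, ‖z‖ ≤ R → ∃ t ∈ T, ‖z - t‖ ≤ δ) ∧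
      (T.card : ℝ) ≤ (1 + 2 * R / δ) ^ d := by
  classical
  let E := EuclideanSpace ℝ (Fin d)
  let Good : Finset E → Prop := fun s => (∀ t ∈ s, ‖t‖ ≤ R) ∧
    (∀ c ∈ s, ∀ e ∈ s, c ≠ e → δ ≤ ‖c - e‖)
  have hcard : ∀ s : Finset E, Good s → (s.card : ℝ) ≤ (1 + 2 * R / δ) ^ d := by
    rintro s ⟨hs, h⟩
    let μ : Measure E := volume
    have hδ2 : 0 < δ / 2 := by positivity
    have ρpos : 0 < R + δ / 2 := by positivity
    have D : Set.Pairwise (s : Set E) (Function.onFun Disjoint fun c => Metric.ball (c : E) (δ/2)) := by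
      rintro c hc e he hce
      apply Metric.ball_disjoint_ball
      rw [dist_eq_norm]
      have := h c hc e he hce
      linarith
    have A_subset : (⋃ c ∈ s, Metric.ball (c : E) (δ/2)) ⊆ Metric.ball (0 : E) (R + δ/2) := by
      refine Set.iUnion₂_subset fun x hx => ?_
      apply Metric.ball_subset_ball'
      rw [dist_zero_right]
      have := hs x hx
      linarith
    have I : (s.card : ENNReal) * ENNReal.ofReal ((δ/2) ^ Module.finrank ℝ E) * μ (Metric.ball 0 1) ≤
        ENNReal.ofReal ((R + δ/2) ^ Module.finrank ℝ E) * μ (Metric.ball 0 1) :=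
      calc
        _ = μ (⋃ c ∈ s, Metric.ball (c : E) (δ/2)) := by
          rw [measure_biUnion_finset D fun c _ => measurableSet_ball]
          simp only [μ.addHaar_ball_of_pos _ hδ2]
          simp only [Finset.sum_const, nsmul_eq_mul, mul_assoc]
        _ ≤ μ (Metric.ball (0 : E) (R + δ/2)) := measure_mono A_subset
        _ = _ := by simp only [μ.addHaar_ball_of_pos _ ρpos]
    have J : (s.card : ENNReal) * ENNReal.ofReal ((δ/2) ^ Module.finrank ℝ E) ≤
        ENNReal.ofReal ((R + δ/2) ^ Module.finrank ℝ E) :=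
      (ENNReal.mul_le_mul_iff_left (Metric.measure_ball_pos _ _ zero_lt_one).ne' measure_ball_lt_top.ne).1 I
    have K := ENNReal.toReal_le_of_le_ofReal (pow_nonneg ρpos.le _) J
    rw [ENNReal.toReal_mul, ENNReal.toReal_ofReal (by positivity)] at K
    have hfr : Module.finrank ℝ E = d := by simp [E]
    rw [hfr] at K
    simp only [ENNReal.toReal_natCast] at K
    have : (1 + 2 * R / δ) ^ d = (R + δ/2)^d / (δ/2)^d := by
      rw [← div_pow]; congr 1; field_simp; ring
    rw [this, le_div_iff₀ (by positivity)]
    exact K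
  obtain ⟨n, hn⟩ := exists_nat_ge ((1 + 2 * R / δ) ^ d)
  let P : ℕ → Prop := fun k => ∃ s : Finset E, Good s ∧ s.card = k
  have hP0 : P 0 := ⟨∅, ⟨by simp, by simp⟩, rfl⟩
  have hspec : P (Nat.findGreatest P n) := Nat.findGreatest_spec (Nat.zero_le n) hP0
  obtain ⟨T, hT, hTc⟩ := hspec
  refine ⟨T, hT.1, ?_, hcard T hT⟩
  intro z hz
  by_contra! hcon
  have hzT : z ∉ T := by
    intro hz'
    have := hcon z hz'
    simp at this
    linarith
  have hG : Good (insert z T) := by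
    refine ⟨?_, ?_⟩
    · intro t ht
      rcases Finset.mem_insert.1 ht with rfl | ht
      · exact hz
      · exact hT.1 t ht
    · intro c hc e he hce
      rcases Finset.mem_insert.1 hc with rfl | hc' <;> rcases Finset.mem_insert.1 he with rfl | he'
      · exact absurd rfl hce
      · exact (hcon e he').le
      · rw [norm_sub_rev]; exact (hcon c hc').le
      · exact hT.2 c hc' e he' hce
  have h1 : T.card + 1 ≤ n := by
    have h2 := hcard _ hG
    rw [Finset.card_insert_of_notMem hzT] at h2
    exact_mod_cast h2.trans hn
  have h3 : T.card + 1 ≤ Nat.findGreatest P n :=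
    Nat.le_findGreatest h1 ⟨insert z T, hG, Finset.card_insert_of_notMem hzT⟩
  omega

lemma mcdiarmid_aux {α : Type*} [MeasurableSpace α] (μ : Measure α) [IsProbabilityMeasure μ]
    (c : ℝ) (hc : 0 ≤ c) (t : ℝ) (n : ℕ) : ∀ (G : (Fin n → α) → ℝ) (_ : Measurable G)
    (C : ℝ) (_ : ∀ w, |G w| ≤ C)
    (_ : ∀ w i a, |G w - G (Function.update w i a)| ≤ c),
    ∫ w, Real.exp (t * (G w - ∫ v, G v ∂(Measure.pi fun _ => μ))) ∂(Measure.pi fun _ => μ)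
      ≤ Real.exp (n * (c^2 * t^2 / 8)) := by
  induction n with
  | zero =>
    intro G hG C hC hd
    have : ∀ w, G w = G default := fun w => by rw [Subsingleton.elim w default]
    simp only [this]
    simp
  | succ n ih =>
    intro G hG C hC hd
    let P : Measure (Fin n → α) := Measure.pi fun _ => μ
    have hmp := (measurePreserving_piFinSuccAbove (fun _ : Fin (n+1) => μ) 0).symm
    have hcons : ∀ p : α × (Fin n → α), (MeasurableEquiv.piFinSuccAbove (fun _ : Fin (n+1) => α) 0).symm p
        = Fin.cons p.1 p.2 := by
      intro p
      simp [MeasurableEquiv.piFinSuccAbove]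
      rfl
    let H : α × (Fin n → α) → ℝ := fun p => G (Fin.cons p.1 p.2)
    have hH : Measurable H := by
      have : H = fun p => G ((MeasurableEquiv.piFinSuccAbove (fun _ : Fin (n+1) => α) 0).symm p) := by
        funext p; rw [hcons]
      rw [this]
      exact hG.comp (MeasurableEquiv.measurable _)
    have key : ∀ φ : ℝ → ℝ, ∫ w, φ (G w) ∂(Measure.pi fun _ : Fin (n+1) => μ) = ∫ p, φ (H p) ∂(μ.prod P) := by
      intro φ
      have := hmp.integral_comp (MeasurableEquiv.measurableEmbedding _) (fun w => φ (G w))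
      rw [← this]
      simp only [hcons]
      rfl
    have hHb : ∀ p, |H p| ≤ C := fun p => hC _
    have hHint : Integrable H (μ.prod P) :=
      Integrable.of_bound hH.aestronglyMeasurable C (Filter.Eventually.of_forall hHb)
    let g : α → ℝ := fun a => ∫ v, H (a, v) ∂P
    have hHa : ∀ a, Measurable fun v => H (a, v) := fun a => hH.comp (by fun_prop)
    have hHai : ∀ a, Integrable (fun v => H (a, v)) P := fun a =>
      Integrable.of_bound (hHa a).aestronglyMeasurable C (Filter.Eventually.of_forall fun v => hHb _)
    have hgm : Measurable g := (hH.stronglyMeasurable.integral_prod_right').measurable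
    have hgb : ∀ a, |g a| ≤ C := by
      intro a
      have := norm_integral_le_of_norm_le_const (μ := P) (f := fun v => H (a, v)) (C := C)
        (Filter.Eventually.of_forall fun v => hHb _)
      simpa using this
    have hgd : ∀ a b, g a - g b ≤ c := by
      intro a b
      simp only [g]
      rw [← integral_sub (hHai a) (hHai b)]
      have : ∫ v, (H (a, v) - H (b, v)) ∂P ≤ ∫ v, c ∂P := by
        apply integral_mono ((hHai a).sub (hHai b)) (integrable_const c)
        intro v
        have := hd (Fin.cons a v) 0 b
        rw [Fin.update_cons_zero] at this
        exact (abs_le.1 this).2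
      simpa using this
    have hEG : ∫ w, G w ∂(Measure.pi fun _ : Fin (n+1) => μ) = ∫ a, g a ∂μ := by
      rw [key (fun x => x), integral_prod _ hHint]
    have hne : Nonempty α := by
      by_contra h
      rw [not_nonempty_iff] at h
      have := IsProbabilityMeasure.measure_univ (μ := μ)
      rw [Set.univ_eq_empty_iff.2 h] at this
      simp at this
    have hbdd : BddBelow (Set.range g) := ⟨-C, by rintro _ ⟨a, rfl⟩; exact (abs_le.1 (hgb a)).1⟩
    have hgI : ∀ a, g a ∈ Set.Icc (⨅ a, g a) ((⨅ a, g a) + c) := by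
      intro a
      refine ⟨ciInf_le hbdd a, ?_⟩
      have : g a - c ≤ ⨅ b, g b := le_ciInf fun b => by linarith [hgd a b]
      linarith
    have hsub := ProbabilityTheory.hasSubgaussianMGF_of_mem_Icc (μ := μ) hgm.aemeasurable
      (Filter.Eventually.of_forall hgI)
    have hmgf := hsub.mgf_le t
    simp only [ProbabilityTheory.mgf] at hmgf
    have hcc : (((‖(⨅ a, g a) + c - ⨅ a, g a‖₊ / 2) ^ 2 : NNReal) : ℝ) * t^2 / 2 = c^2 * t^2 / 8 := by
      push_cast
      rw [add_sub_cancel_left, Real.norm_eq_abs, div_pow, sq_abs]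
      ring
    rw [hcc] at hmgf
    rw [hEG, key (fun x => Real.exp (t * (x - ∫ a, g a ∂μ)))]
    set m0 := ∫ a, g a ∂μ with hm0
    have hm0b : |m0| ≤ C := by
      have := norm_integral_le_of_norm_le_const (μ := μ) (f := g) (C := C)
        (Filter.Eventually.of_forall fun v => hgb _)
      simpa using this
    have hexpb : ∀ x y : ℝ, |x| ≤ C → |y| ≤ C → ‖Real.exp (t * (x - y))‖ ≤ Real.exp (|t| * (2 * C)) := by
      intro x y hx hy
      rw [Real.norm_eq_abs, Real.abs_exp]
      apply Real.exp_le_exp.2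
      calc t * (x - y) ≤ |t * (x - y)| := le_abs_self _
        _ = |t| * |x - y| := abs_mul _ _
        _ ≤ |t| * (2 * C) := by
          gcongr
          have := abs_sub x y
          linarith
    have hI1 : Integrable (fun p => Real.exp (t * (H p - m0))) (μ.prod P) :=
      Integrable.of_bound (by fun_prop) _ (Filter.Eventually.of_forall fun p => hexpb _ _ (hHb p) hm0b)
    rw [integral_prod _ hI1]
    have hstep : ∀ a, ∫ v, Real.exp (t * (H (a, v) - m0)) ∂P
        ≤ Real.exp (n * (c^2 * t^2 / 8)) * Real.exp (t * (g a - m0)) := by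
      intro a
      have h1 : ∀ v, Real.exp (t * (H (a, v) - m0)) =
          Real.exp (t * (H (a, v) - g a)) * Real.exp (t * (g a - m0)) := by
        intro v; rw [← Real.exp_add]; congr 1; ring
      simp only [h1]
      rw [integral_mul_const]
      apply mul_le_mul_of_nonneg_right _ (Real.exp_pos _).le
      apply ih (fun v => H (a, v)) (hHa a) C (fun v => hHb _)
      intro w i b
      have := hd (Fin.cons a w) i.succ b
      rw [← Fin.cons_update] at this
      exact this
    have hI2 : Integrable (fun a => Real.exp (t * (g a - m0))) μ :=
      Integrable.of_bound (by fun_prop) _ (Filter.Eventually.of_forall fun p => hexpb _ _ (hgb p) hm0b)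
    calc ∫ a, ∫ v, Real.exp (t * (H (a, v) - m0)) ∂P ∂μ
        ≤ ∫ a, Real.exp (n * (c^2 * t^2 / 8)) * Real.exp (t * (g a - m0)) ∂μ := by
          exact integral_mono hI1.integral_prod_left (hI2.const_mul _) hstep
      _ = Real.exp (n * (c^2 * t^2 / 8)) * ∫ a, Real.exp (t * (g a - m0)) ∂μ := integral_const_mul _ _
      _ ≤ Real.exp (n * (c^2 * t^2 / 8)) * Real.exp (c^2 * t^2 / 8) := by gcongr
      _ = _ := by rw [← Real.exp_add]; congr 1; push_cast; ring

lemma mcdiarmid_tail {α : Type*} [MeasurableSpace α] (μ : Measure α) [IsProbabilityMeasure μ]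
    (n : ℕ) (hn : 1 ≤ n) (G : (Fin n → α) → ℝ) (hG : Measurable G)
    (C : ℝ) (hC : ∀ w, |G w| ≤ C)
    (hd : ∀ w i a, |G w - G (Function.update w i a)| ≤ 2 / n) (τ : ℝ) (hτ : 0 < τ) (B : ℝ)
    (hB : ∫ v, G v ∂(Measure.pi fun _ => μ) ≤ B) :
    1 - ENNReal.ofReal (Real.exp (-τ)) ≤
      (Measure.pi fun _ => μ) {w | G w ≤ B + Real.sqrt (2 * τ / n)} := by
  set P : Measure (Fin n → α) := Measure.pi fun _ => μ with hP
  set m0 := ∫ v, G v ∂P with hm0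
  have hn0 : (0:ℝ) < n := by exact_mod_cast hn
  set s := Real.sqrt (2 * τ / n) with hs
  have hs2 : s^2 = 2 * τ / n := Real.sq_sqrt (by positivity)
  have hsp : 0 < s := Real.sqrt_pos.2 (by positivity)
  let t := n * s
  have ht : 0 < t := by positivity
  have hmg := mcdiarmid_aux μ (2 / n) (by positivity) t n G hG C hC hd
  have hm0b : |m0| ≤ C := by
    have := norm_integral_le_of_norm_le_const (μ := P) (f := G) (C := C)
      (Filter.Eventually.of_forall fun v => hC _)
    simpa using this
  have hI : Integrable (fun w => Real.exp (t * (G w - m0))) P := by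
    refine Integrable.of_bound (by fun_prop) (Real.exp (t * (2 * C))) (Filter.Eventually.of_forall fun w => ?_)
    rw [Real.norm_eq_abs, Real.abs_exp]
    apply Real.exp_le_exp.2
    gcongr
    have h1 := (abs_le.1 (hC w)).2
    have h2 := (abs_le.1 hm0b).1
    linarith
  have hch := ProbabilityTheory.measure_ge_le_exp_mul_mgf (μ := P) (X := fun w => G w - m0) s ht.le hI
  have hbad : P.real {w | s ≤ G w - m0} ≤ Real.exp (-τ) := by
    refine hch.trans ?_
    calc Real.exp (-t * s) * ProbabilityTheory.mgf (fun w => G w - m0) P t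
        ≤ Real.exp (-t * s) * Real.exp (n * ((2 / n : ℝ)^2 * t^2 / 8)) := by
          gcongr; exact hmg
      _ = Real.exp (-τ) := by
          rw [← Real.exp_add]
          congr 1
          have : t = n * s := rfl
          rw [this]
          have h3 : n * s^2 = 2 * τ := by rw [hs2]; field_simp
          field_simp
          nlinarith
  have hset : {w | G w ≤ B + s}ᶜ ⊆ {w | s ≤ G w - m0} := by
    intro w hw
    simp only [Set.mem_compl_iff, Set.mem_ofPred_eq, not_le] at hw ⊢
    linarith
  have hmeas : MeasurableSet {w | G w ≤ B + s} := measurableSet_le hG measurable_const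
  have h5 : P {w | G w ≤ B + s}ᶜ ≤ ENNReal.ofReal (Real.exp (-τ)) := by
    refine (measure_mono hset).trans ?_
    rw [← ofReal_measureReal]
    exact ENNReal.ofReal_le_ofReal hbad
  rw [prob_compl_eq_one_sub hmeas] at h5
  rw [tsub_le_iff_left] at h5 ⊢
  rwa [add_comm]

lemma MeasureTheory.Integrable.fadd {α : Type*} [MeasurableSpace α] {μ : Measure α} {f g : α → ℝ}
    (hf : Integrable f μ) (hg : Integrable g μ) : Integrable (fun x => f x + g x) μ := hf.add hg

lemma MeasureTheory.Integrable.fsub {α : Type*} [MeasurableSpace α] {μ : Measure α} {f g : α → ℝ}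
    (hf : Integrable f μ) (hg : Integrable g μ) : Integrable (fun x => f x - g x) μ := hf.sub hg

lemma max_aux {α ι : Type*} [MeasurableSpace α] (μ : Measure α) [IsProbabilityMeasure μ]
    (m : ℕ) (hm : 1 ≤ m) (T : Finset ι) (hT : T.Nonempty) (X : ι → α → ℝ) (hX : ∀ t, Measurable (X t))
    (hXb : ∀ t a, |X t a| ≤ 2) (b : α → ℝ) (hb : ∀ t ∈ T, ∀ a, |X t a| ≤ b a)
    (hbi : Integrable (fun a => b a ^ 2) μ) (V : ℝ) (hV : 0 < V) (hbV : ∫ a, b a ^ 2 ∂μ ≤ V) :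
    ∃ M : (Fin m → α) → ℝ, Integrable M (Measure.pi fun _ => μ) ∧
      (∀ t ∈ T, ∀ w, |(∫ a, X t a ∂μ) - (1 / m) * ∑ j, X t (w j)| ≤ M w) ∧
      ∫ w, M w ∂(Measure.pi fun _ => μ) ≤ 2 * Real.sqrt (Real.log (2 * T.card) * V / m) := by
  set P : Measure (Fin m → α) := Measure.pi fun _ => μ with hP
  have hm0 : (0:ℝ) < m := by exact_mod_cast hm
  have hN : (1:ℝ) ≤ T.card := by exact_mod_cast hT.card_pos
  set N : ℝ := (T.card : ℝ) with hNdef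
  set ℓ := Real.log (2 * N) with hℓ
  have hℓ0 : 0 < ℓ := Real.log_pos (by linarith)
  let lam := Real.sqrt (ℓ / (m * V))
  have hlam : 0 < lam := Real.sqrt_pos.2 (by positivity)
  have hlam2 : lam ^ 2 = ℓ / (m * V) := Real.sq_sqrt (by positivity)
  let e : ι → ℝ := fun t => ∫ a, X t a ∂μ
  have hXi : ∀ t, Integrable (X t) μ := fun t =>
    Integrable.of_bound (hX t).aestronglyMeasurable 2 (Filter.Eventually.of_forall (hXb t))
  have hX2i : ∀ t, Integrable (fun a => X t a ^ 2) μ := fun t =>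
    Integrable.of_bound ((hX t).pow_const 2).aestronglyMeasurable 4 (Filter.Eventually.of_forall fun a => by
      rw [Real.norm_eq_abs, abs_of_nonneg (sq_nonneg _), ← sq_abs]
      nlinarith [hXb t a, abs_nonneg (X t a)])
  have hX2 : ∀ t ∈ T, ∫ a, X t a ^ 2 ∂μ ≤ V := by
    intro t ht
    refine le_trans (integral_mono (hX2i t) hbi fun a => ?_) hbV
    simp only
    rw [← sq_abs]
    exact pow_le_pow_left₀ (abs_nonneg _) (hb t ht a) 2
  have hY2 : ∀ t, ∫ a, (X t a - e t) ^ 2 ∂μ = ∫ a, X t a ^ 2 ∂μ - e t ^ 2 := by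
    intro t
    have h1 : ∀ a, (X t a - e t)^2 = X t a ^ 2 - 2 * e t * X t a + e t ^ 2 := fun a => by ring
    simp only [h1]
    rw [integral_add ((hX2i t).fsub ((hXi t).const_mul _)) (integrable_const _),
      integral_sub (hX2i t) ((hXi t).const_mul _), integral_const_mul]
    simp [e]
    ring
  have he2 : ∀ t ∈ T, e t ^ 2 ≤ V := by
    intro t ht
    have h1 : 0 ≤ ∫ a, (X t a - e t) ^ 2 ∂μ := integral_nonneg fun a => sq_nonneg _
    rw [hY2] at h1
    linarith [hX2 t ht]
  -- single-variable mgf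
  let ψ : ι → ℝ → α → ℝ := fun t s a => Real.exp (s * (X t a - e t) - (s * (X t a - e t))^2 / 6)
  have hψm : ∀ t s, Measurable (ψ t s) := by
    intro t s
    have := hX t
    fun_prop
  have hψi : ∀ t s, Integrable (ψ t s) μ := by
    intro t s
    refine Integrable.of_bound (hψm t s).aestronglyMeasurable (Real.exp 2) (Filter.Eventually.of_forall fun a => ?_)
    rw [Real.norm_eq_abs, Real.abs_exp]
    apply Real.exp_le_exp.2
    nlinarith [sq_nonneg (s * (X t a - e t) - 3)]
  have hψ : ∀ t ∈ T, ∀ s, ∫ a, ψ t s a ∂μ ≤ Real.exp (s^2 * V / 3) := by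
    intro t ht s
    have hi2 : Integrable (fun a => (X t a - e t)^2) μ := by
      have h1 : ∀ a, (X t a - e t)^2 = X t a ^ 2 - 2 * e t * X t a + e t ^ 2 := fun a => by ring
      simp only [h1]
      exact ((hX2i t).fsub ((hXi t).const_mul _)).fadd (integrable_const _)
    have hi1 : Integrable (fun a => X t a - e t) μ := (hXi t).fsub (integrable_const _)
    have h0 : ∫ a, (X t a - e t) ∂μ = 0 := by
      rw [integral_sub (hXi t) (integrable_const _)]; simp [e]
    calc ∫ a, ψ t s a ∂μ ≤ ∫ a, (1 + s * (X t a - e t) + s^2/3 * (X t a - e t)^2) ∂μ := by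
          apply integral_mono (hψi t s) (((integrable_const _).fadd (hi1.const_mul _)).fadd (hi2.const_mul _))
          intro a
          have := exp_aux (s * (X t a - e t))
          simp only [ψ]
          refine this.trans (le_of_eq ?_)
          ring
      _ = 1 + s^2/3 * (∫ a, X t a ^ 2 ∂μ - e t ^ 2) := by
          rw [integral_add ((integrable_const _).fadd (hi1.const_mul _)) (hi2.const_mul _),
            integral_add (integrable_const _) (hi1.const_mul _), integral_const_mul, integral_const_mul, h0, hY2]
          simp
      _ ≤ 1 + s^2/3 * V := by
          have := hX2 t ht
          have := sq_nonneg (e t)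
          gcongr
          linarith
      _ ≤ Real.exp (s^2 * V / 3) := by
          have := Real.add_one_le_exp (s^2 * V / 3)
          linarith
  let Z : ι → ℝ → (Fin m → α) → ℝ := fun t s w => ∏ j, ψ t s (w j)
  have hZi : ∀ t s, Integrable (Z t s) P := fun t s =>
    Integrable.fintype_prod (fun j => hψi t s)
  have hZ : ∀ t ∈ T, ∀ s, ∫ w, Z t s w ∂P ≤ Real.exp (m * (s^2 * V / 3)) := by
    intro t ht s
    have h1 : ∫ w, Z t s w ∂P = ∏ j : Fin m, ∫ a, ψ t s a ∂μ :=
      integral_fintype_prod_eq_prod (fun _ : Fin m => ψ t s)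
    rw [h1, Finset.prod_const, Finset.card_univ, Fintype.card_fin, Real.exp_nat_mul]
    exact pow_le_pow_left₀ (integral_nonneg fun a => (Real.exp_pos _).le) (hψ t ht s) m
  have hZexp : ∀ t s w, Z t s w = Real.exp (∑ j, (s * (X t (w j) - e t) - (s * (X t (w j) - e t))^2 / 6)) := by
    intro t s w
    simp only [Z, ψ]
    rw [Real.exp_sum]
  let c := ℓ + m * (lam^2 * V / 3)
  let W : (Fin m → α) → ℝ := fun w => ∑ j, (2 * b (w j) ^ 2 + 2 * V)
  have hbj : ∀ j : Fin m, MeasurePreserving (fun w : Fin m → α => w j) P μ := fun j =>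
    measurePreserving_eval (fun _ => μ) j
  have hbji : ∀ j : Fin m, Integrable (fun w : Fin m → α => b (w j) ^ 2) P := fun j =>
    (hbj j).integrable_comp_of_integrable hbi
  have hWi : Integrable W P := by
    apply integrable_finsetSum
    intro j _
    exact ((hbji j).const_mul 2).fadd (integrable_const _)
  have hbjI : ∀ j : Fin m, ∫ w, b (w j) ^ 2 ∂P = ∫ a, b a ^ 2 ∂μ := by
    intro j
    have h1 := integral_map (hbj j).measurable.aemeasurable (f := fun a => b a ^ 2)
      (by rw [(hbj j).map_eq]; exact hbi.aestronglyMeasurable)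
    rw [(hbj j).map_eq] at h1
    exact h1.symm
  have hWI : ∫ w, W w ∂P ≤ m * (4 * V) := by
    simp only [W]
    rw [integral_finsetSum _ (fun j _ => ((hbji j).const_mul 2).fadd (integrable_const _))]
    have : ∀ j ∈ Finset.univ, ∫ w : Fin m → α, (2 * b (w j) ^ 2 + 2 * V) ∂P ≤ 4 * V := by
      intro j _
      rw [integral_add ((hbji j).const_mul 2) (integrable_const _), integral_const_mul, hbjI]
      simp
      linarith
    refine (Finset.sum_le_sum this).trans ?_
    simp
  let ZZ : (Fin m → α) → ℝ := fun w => ∑ t ∈ T, (Z t lam w + Z t (-lam) w)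
  have hZZi : Integrable ZZ P := integrable_finsetSum _ fun t _ => (hZi t _).fadd (hZi t _)
  have hZZ : ∫ w, ZZ w ∂P ≤ Real.exp c := by
    simp only [ZZ]
    rw [integral_finsetSum _ (fun t _ => (hZi t _).fadd (hZi t _))]
    have : ∀ t ∈ T, ∫ w, (Z t lam w + Z t (-lam) w) ∂P ≤ 2 * Real.exp (m * (lam^2 * V / 3)) := by
      intro t ht
      rw [integral_add (hZi t _) (hZi t _)]
      have h1 := hZ t ht lam
      have h2 := hZ t ht (-lam)
      rw [neg_sq] at h2
      linarith
    refine (Finset.sum_le_sum this).trans (le_of_eq ?_)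
    simp only [c]
    rw [Real.exp_add, hℓ, Real.exp_log (by linarith), Finset.sum_const, nsmul_eq_mul]
    ring
  refine ⟨fun w => (1 / (m * lam)) * (c - 1 + Real.exp (-c) * ZZ w + lam^2/6 * W w), ?_, ?_, ?_⟩
  · exact ((((integrable_const _).fadd (hZZi.const_mul _))).fadd (hWi.const_mul _)).const_mul _
  · intro t ht w
    -- sum bound
    have hS : ∀ s, s^2 = lam^2 → Z t s w ≤ ZZ w →
        s * ∑ j, (X t (w j) - e t) ≤ c - 1 + Real.exp (-c) * ZZ w + lam^2/6 * W w := by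
      intro s hs hle
      have h1 : s * ∑ j, (X t (w j) - e t) - lam^2/6 * W w ≤
          ∑ j, (s * (X t (w j) - e t) - (s * (X t (w j) - e t))^2 / 6) := by
        simp only [W]
        rw [Finset.mul_sum, Finset.mul_sum, ← Finset.sum_sub_distrib]
        apply Finset.sum_le_sum
        intro j _
        have h2 : X t (w j) ^ 2 ≤ b (w j) ^ 2 := by
          rw [← sq_abs]
          exact pow_le_pow_left₀ (abs_nonneg _) (hb t ht _) 2
        have h3 := he2 t ht
        have h4 : (X t (w j) - e t)^2 ≤ 2 * b (w j)^2 + 2 * V := by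
          nlinarith [sq_nonneg (X t (w j) + e t)]
        rw [mul_pow, hs]
        have h5 : lam^2 * (X t (w j) - e t)^2 ≤ lam^2 * (2 * b (w j)^2 + 2 * V) := by gcongr
        linarith
      have h2 := Real.add_one_le_exp (s * ∑ j, (X t (w j) - e t) - lam^2/6 * W w - c)
      have h3 : Real.exp (s * ∑ j, (X t (w j) - e t) - lam^2/6 * W w - c) ≤ Real.exp (-c) * ZZ w := by
        calc _ ≤ Real.exp (-c + ∑ j, (s * (X t (w j) - e t) - (s * (X t (w j) - e t))^2 / 6)) := by
              apply Real.exp_le_exp.2; linarith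
          _ = Real.exp (-c) * Z t s w := by rw [Real.exp_add, hZexp]
          _ ≤ _ := by gcongr
      linarith
    have hZpos : ∀ t s, 0 ≤ Z t s w := fun t s => Finset.prod_nonneg fun j _ => (Real.exp_pos _).le
    have hle : Z t lam w + Z t (-lam) w ≤ ZZ w :=
      Finset.single_le_sum (f := fun t => Z t lam w + Z t (-lam) w)
        (fun t _ => add_nonneg (hZpos _ _) (hZpos _ _)) ht
    have hp := hS lam rfl (by linarith [hZpos t (-lam)])
    have hn := hS (-lam) (neg_sq _) (by linarith [hZpos t lam])
    have hsum : ∑ j, (X t (w j) - e t) = ∑ j, X t (w j) - m * e t := by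
      rw [Finset.sum_sub_distrib]; simp
    have heq : (∫ a, X t a ∂μ) - (1 / m) * ∑ j, X t (w j) = (1 / (m * lam)) * (-lam * ∑ j, (X t (w j) - e t)) := by
      rw [hsum]
      change e t - _ = _
      field_simp
      ring
    rw [heq, abs_mul, abs_of_pos (by positivity : 0 < 1 / (m * lam))]
    apply mul_le_mul_of_nonneg_left _ (by positivity)
    rw [abs_le]
    constructor <;> linarith
  · beta_reduce
    rw [integral_const_mul, integral_add ((integrable_const _).fadd (hZZi.const_mul _)) (hWi.const_mul _),
      integral_add (integrable_const _) (hZZi.const_mul _), integral_const_mul, integral_const_mul]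
    have h1 : Real.exp (-c) * ∫ w, ZZ w ∂P ≤ 1 := by
      calc _ ≤ Real.exp (-c) * Real.exp c := by gcongr
        _ = 1 := by rw [← Real.exp_add]; simp
    have h2 : lam^2/6 * ∫ w, W w ∂P ≤ lam^2/6 * (m * (4 * V)) := by gcongr
    have h3 : ∫ w : Fin m → α, (c - 1) ∂P = c - 1 := by simp
    rw [h3]
    have hlm : lam^2 * (m * V) = ℓ := by rw [hlam2]; field_simp
    have h4 : Real.sqrt (ℓ * V / m) = ℓ / (m * lam) := by
      rw [Real.sqrt_eq_iff_mul_self_eq (by positivity) (by positivity)]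
      rw [div_mul_div_comm, div_eq_div_iff (by positivity) (by positivity)]
      symm
      calc ℓ * ℓ * m = ℓ * m * ℓ := by ring
        _ = ℓ * m * (lam^2 * (m * V)) := by rw [hlm]
        _ = _ := by ring
    rw [h4]
    calc _ ≤ 1 / (m * lam) * (c - 1 + 1 + lam^2/6 * (m * (4 * V))) := by gcongr
      _ = 1 / (m * lam) * (ℓ + lam^2 * (m * V)) := by simp only [c]; ring
      _ = 2 * (ℓ / (m * lam)) := by rw [hlm]; ring

lemma cos_lip (x y : ℝ) : |Real.cos x - Real.cos y| ≤ |x - y| := by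
  rw [Real.cos_sub_cos, abs_mul, abs_mul]
  have h1 := Real.abs_sin_le_one ((x + y) / 2)
  have h2 : |Real.sin ((x - y) / 2)| ≤ |(x - y) / 2| := Real.abs_sin_le_abs
  rw [abs_div] at h2
  norm_num at h2 ⊢
  nlinarith [abs_nonneg (Real.sin ((x - y) / 2)), abs_nonneg (Real.sin ((x + y) / 2))]

lemma cos_inner_lip {d : ℕ} (w z t : EuclideanSpace ℝ (Fin d)) :
    |Real.cos ⟪w, z⟫ - Real.cos ⟪w, t⟫| ≤ ‖w‖ * ‖z - t‖ := by
  refine (cos_lip _ _).trans ?_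
  rw [← inner_sub_right]
  exact abs_real_inner_le_norm _ _

lemma log_net (d : ℕ) (hd : 1 ≤ d) (D σ : ℝ) (hD : 0 < D) (hσ : 0 ≤ σ) (k : ℕ) (N : ℝ) (hN1 : 1 ≤ N)
    (hN : N ≤ (1 + 2 * D / ((1/2)^k / (1 + σ))) ^ d) :
    Real.sqrt (Real.log (2 * N)) ≤ Real.sqrt d * (Real.sqrt (Real.log (2 * D + 1)) +
      Real.sqrt (Real.log (σ + 1)) + (k + 2) / 2) := by
  have hd' : (1:ℝ) ≤ d := by exact_mod_cast hd
  have ha : 0 ≤ Real.log (2 * D + 1) := Real.log_nonneg (by linarith)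
  have hs : 0 ≤ Real.log (σ + 1) := Real.log_nonneg (by linarith)
  have hl2 : Real.log 2 ≤ 1 := by have := Real.log_two_lt_d9; linarith
  have hl20 : 0 ≤ Real.log 2 := Real.log_nonneg (by norm_num)
  have h1 : 1 + 2 * D / ((1/2)^k / (1 + σ)) ≤ (2 * D + 1) * (σ + 1) * 2^k := by
    have : 2 * D / ((1/2)^k / (1 + σ)) = 2 * D * (σ + 1) * 2^k := by
      rw [one_div, inv_pow]; field_simp; ring
    rw [this]
    have h2 : (1:ℝ) ≤ 2^k := one_le_pow₀ (by norm_num)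
    nlinarith [mul_nonneg hσ (zero_le_one.trans h2)]
  have h0 : 0 ≤ 1 + 2 * D / ((1/2)^k / (1 + σ)) := by positivity
  have h2 : Real.log (2 * N) ≤ d * (Real.log (2 * D + 1) + Real.log (σ + 1) + (k + 1)) := by
    rw [Real.log_mul (by norm_num) (by linarith)]
    have h3 : Real.log N ≤ d * (Real.log (2 * D + 1) + Real.log (σ + 1) + k * Real.log 2) := by
      calc Real.log N ≤ Real.log (((2 * D + 1) * (σ + 1) * 2^k)^d) :=
            Real.log_le_log (by linarith) (hN.trans (pow_le_pow_left₀ h0 h1 d))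
        _ = _ := by
          rw [Real.log_pow, Real.log_mul (by positivity) (by positivity),
            Real.log_mul (by positivity) (by positivity), Real.log_pow]
    have h4 : (k:ℝ) * Real.log 2 ≤ k := by
      have : (0:ℝ) ≤ k := Nat.cast_nonneg k
      nlinarith
    have h5 : d * (Real.log (2 * D + 1) + Real.log (σ + 1) + k * Real.log 2) ≤
      d * (Real.log (2 * D + 1) + Real.log (σ + 1) + k) := by gcongr
    linarith
  have hsum : Real.sqrt (Real.log (2 * D + 1) + Real.log (σ + 1) + (k + 1)) ≤
      Real.sqrt (Real.log (2 * D + 1)) + Real.sqrt (Real.log (σ + 1)) + (k + 2) / 2 := by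
    apply Real.sqrt_le_iff.2
    have e1 := Real.sq_sqrt ha
    have e2 := Real.sq_sqrt hs
    have p1 := Real.sqrt_nonneg (Real.log (2 * D + 1))
    have p2 := Real.sqrt_nonneg (Real.log (σ + 1))
    have pk : (0:ℝ) ≤ k := Nat.cast_nonneg k
    refine ⟨by positivity, ?_⟩
    nlinarith [mul_nonneg p1 p2, mul_nonneg p1 pk, mul_nonneg p2 pk, mul_nonneg pk pk]
  calc _ ≤ Real.sqrt (d * (Real.log (2 * D + 1) + Real.log (σ + 1) + (k + 1))) := Real.sqrt_le_sqrt h2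
    _ = Real.sqrt d * Real.sqrt (Real.log (2 * D + 1) + Real.log (σ + 1) + (k + 1)) :=
      Real.sqrt_mul (by positivity) _
    _ ≤ _ := by gcongr

lemma chain_aux (d m : ℕ) (hd : 1 ≤ d) (hm : 1 ≤ m)
    (Λ : Measure (EuclideanSpace ℝ (Fin d))) [IsProbabilityMeasure Λ]
    (hσint : Integrable (fun ω : EuclideanSpace ℝ (Fin d) => ‖ω‖ ^ 2) Λ)
    (σ : ℝ) (hσ : σ = Real.sqrt (∫ ω, ‖ω‖ ^ 2 ∂Λ)) (D : ℝ) (hD : 0 < D) :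
    ∃ M : (Fin m → EuclideanSpace ℝ (Fin d)) → ℝ, Integrable M (Measure.pi fun _ => Λ) ∧
      (∀ z, ‖z‖ ≤ D → ∀ w : Fin m → EuclideanSpace ℝ (Fin d),
        |(∫ ω, Real.cos ⟪ω, z⟫ ∂Λ) - (1 / m) * ∑ j, Real.cos ⟪w j, z⟫| ≤ M w) ∧
      ∫ w, M w ∂(Measure.pi fun _ => Λ) ≤ Real.sqrt d / Real.sqrt m *
        (8 * (Real.sqrt (Real.log (2 * D + 1)) + Real.sqrt (Real.log (σ + 1))) + 14) := by
  have hσ0 : 0 ≤ σ := hσ ▸ Real.sqrt_nonneg _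
  have hσ2 : ∫ ω, ‖ω‖ ^ 2 ∂Λ = σ^2 := by
    rw [hσ, Real.sq_sqrt (integral_nonneg fun _ => by positivity)]
  have hm0 : (0:ℝ) < m := by exact_mod_cast hm
  have hd0 : (1:ℝ) ≤ d := by exact_mod_cast hd
  set P : Measure (Fin m → EuclideanSpace ℝ (Fin d)) := Measure.pi fun _ => Λ with hP
  set Q := Real.sqrt (Real.log (2 * D + 1)) + Real.sqrt (Real.log (σ + 1)) with hQ
  have hQ0 : 0 ≤ Q := by positivity
  let f : (Fin m → EuclideanSpace ℝ (Fin d)) → EuclideanSpace ℝ (Fin d) → ℝ :=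
    fun w z => (∫ ω, Real.cos ⟪ω, z⟫ ∂Λ) - (1 / m) * ∑ j, Real.cos ⟪w j, z⟫
  have hcosm : ∀ z : EuclideanSpace ℝ (Fin d), Measurable fun ω : EuclideanSpace ℝ (Fin d) => Real.cos ⟪ω, z⟫ := by
    intro z; fun_prop
  have hcosi : ∀ z : EuclideanSpace ℝ (Fin d), Integrable (fun ω : EuclideanSpace ℝ (Fin d) => Real.cos ⟪ω, z⟫) Λ :=
    fun z => Integrable.of_bound (hcosm z).aestronglyMeasurable 1
      (Filter.Eventually.of_forall fun _ => Real.abs_cos_le_one _)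
  let δ : ℕ → ℝ := fun k => (1/2)^k / (1 + σ)
  have hδ : ∀ k, 0 < δ k := fun k => by positivity
  choose T hTD hTn hTc using fun k => net_aux d D (δ k) hD.le (hδ k)
  have hTne : ∀ k, (T k).Nonempty := fun k => by
    obtain ⟨t, ht, _⟩ := hTn k 0 (by simpa using hD.le)
    exact ⟨t, ht⟩
  have hT1 : ∀ k, (1:ℝ) ≤ (T k).card := fun k => by exact_mod_cast (hTne k).card_pos
  have hlog : ∀ k, Real.sqrt (Real.log (2 * (T k).card)) ≤ Real.sqrt d * (Q + (k + 2) / 2) := fun k =>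
    log_net d hd D σ hD hσ0 k _ (hT1 k) (hTc k)
  have hsm : 0 < Real.sqrt m := Real.sqrt_pos.2 hm0
  have hlev : ∀ k (v : ℝ), 0 ≤ v → 2 * Real.sqrt (Real.log (2 * (T k).card) * v^2 / m) ≤
      Real.sqrt d / Real.sqrt m * (v * (2 * Q + k + 2)) := by
    intro k v hv
    have hl : 0 ≤ Real.log (2 * (T k).card) := Real.log_nonneg (by linarith [hT1 k])
    rw [Real.sqrt_div (by positivity), Real.sqrt_mul hl, Real.sqrt_sq hv]
    have := hlog k
    calc 2 * (Real.sqrt (Real.log (2 * (T k).card)) * v / Real.sqrt m)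
        ≤ 2 * ((Real.sqrt d * (Q + (k + 2) / 2)) * v / Real.sqrt m) := by gcongr
      _ = _ := by ring
  have hchain : ∀ K : ℕ, ∃ M : (Fin m → EuclideanSpace ℝ (Fin d)) → ℝ, Integrable M P ∧
      (∀ t ∈ T K, ∀ w, |f w t| ≤ M w) ∧
      ∫ w, M w ∂P ≤ Real.sqrt d / Real.sqrt m * (8 * Q + 12 - (1/2)^K * (4 * Q + 2 * K + 8)) := by
    intro K
    induction K with
    | zero =>
      obtain ⟨M, hM1, hM2, hM3⟩ := max_aux Λ m hm (T 0) (hTne 0) (fun t ω => Real.cos ⟪ω, t⟫)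
        hcosm (fun t a => (Real.abs_cos_le_one _).trans (by norm_num)) (fun _ => 1)
        (fun t _ a => Real.abs_cos_le_one _) (integrable_const _) (1^2) (by norm_num) (by simp)
      refine ⟨M, hM1, hM2, hM3.trans ((hlev 0 1 zero_le_one).trans ?_)⟩
      gcongr
      push_cast
      norm_num
      linarith
    | succ K ih =>
      obtain ⟨M, hM1, hM2, hM3⟩ := ih
      choose! p hpT hpd using hTn K
      let v : ℝ := (1/2)^K
      obtain ⟨M', hM1', hM2', hM3'⟩ := max_aux Λ m hm (T (K+1)) (hTne (K+1))
        (fun t ω => Real.cos ⟪ω, t⟫ - Real.cos ⟪ω, p t⟫)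
        (fun t => (hcosm t).sub (hcosm (p t)))
        (fun t a => (abs_sub _ _).trans (by
          have h1 := Real.abs_cos_le_one ⟪a, t⟫
          have h2 := Real.abs_cos_le_one ⟪a, p t⟫
          linarith)) (fun ω => ‖ω‖ * δ K)
        (fun t ht a => (cos_inner_lip a t (p t)).trans (by
          have := hpd t (hTD _ t ht)
          gcongr))
        (by simp only [mul_pow]; exact hσint.mul_const _) (v^2) (by positivity)
        (by
          simp only [mul_pow]
          rw [integral_mul_const, hσ2, ← mul_pow]
          apply pow_le_pow_left₀ (by have := hδ K; positivity)
          simp only [δ, v]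
          rw [mul_div_assoc', div_le_iff₀ (by positivity)]
          have : (0:ℝ) < (1/2)^K := by positivity
          nlinarith)
      refine ⟨fun w => M w + M' w, hM1.add hM1', ?_, ?_⟩
      · intro t ht w
        have hz := hTD _ t ht
        have h1 := hM2 (p t) (hpT t hz) w
        have h2 := hM2' t ht w
        rw [integral_sub (hcosi t) (hcosi (p t)), Finset.sum_sub_distrib] at h2
        have h3 : f w t = f w (p t) + ((∫ ω, Real.cos ⟪ω, t⟫ ∂Λ) - (∫ ω, Real.cos ⟪ω, p t⟫ ∂Λ) -
            1 / m * (∑ j, Real.cos ⟪w j, t⟫ - ∑ j, Real.cos ⟪w j, p t⟫)) := by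
          simp only [f]; ring
        rw [h3]
        exact (abs_add_le _ _).trans (add_le_add h1 h2)
      · rw [integral_add hM1 hM1']
        have h4 := hM3'.trans (hlev (K+1) v (by positivity))
        refine (add_le_add hM3 h4).trans (le_of_eq ?_)
        rw [← mul_add]
        congr 1
        simp only [v]
        push_cast
        ring
  obtain ⟨M, hM1, hM2, hM3⟩ := hchain m
  have hni : Integrable (fun ω : EuclideanSpace ℝ (Fin d) => ‖ω‖) Λ := by
    refine Integrable.mono' (hσint.fadd (integrable_const 1)) (by fun_prop) (Filter.Eventually.of_forall fun a => ?_)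
    simp only [norm_norm, Pi.add_apply]
    nlinarith [sq_nonneg (‖a‖ - 1), norm_nonneg a]
  set e1 := ∫ ω, ‖ω‖ ∂Λ with he1
  have he1σ : e1 ≤ σ := by
    have h1 : 0 ≤ ∫ ω, (‖ω‖ - e1)^2 ∂Λ := integral_nonneg fun _ => sq_nonneg _
    have h2 : ∀ ω : EuclideanSpace ℝ (Fin d), (‖ω‖ - e1)^2 = ‖ω‖^2 - 2 * e1 * ‖ω‖ + e1^2 := fun ω => by ring
    simp only [h2] at h1
    rw [integral_add (hσint.fsub (hni.const_mul _)) (integrable_const _),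
      integral_sub hσint (hni.const_mul _), integral_const_mul, hσ2, ← he1] at h1
    simp at h1
    apply le_of_sq_le_sq _ hσ0
    linarith
  have hev : ∀ j : Fin m, MeasurePreserving (fun w : Fin m → EuclideanSpace ℝ (Fin d) => w j) P Λ := fun j =>
    measurePreserving_eval (fun _ => Λ) j
  have hji : ∀ j : Fin m, Integrable (fun w : Fin m → EuclideanSpace ℝ (Fin d) => ‖w j‖) P := fun j =>
    (hev j).integrable_comp_of_integrable hni
  have hjI : ∀ j : Fin m, ∫ w, ‖w j‖ ∂P = e1 := by
    intro j
    have h1 := integral_map (hev j).measurable.aemeasurable (f := fun a => ‖a‖)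
      (by rw [(hev j).map_eq]; exact hni.aestronglyMeasurable)
    rw [(hev j).map_eq] at h1
    exact h1.symm
  have hsi : Integrable (fun w : Fin m → EuclideanSpace ℝ (Fin d) => ∑ j, ‖w j‖) P :=
    integrable_finsetSum _ fun j _ => hji j
  refine ⟨fun w => M w + (e1 + (1/m) * ∑ j, ‖w j‖) * δ m, ?_, ?_, ?_⟩
  · exact hM1.fadd (((integrable_const _).fadd (hsi.const_mul _)).mul_const _)
  · intro z hz w
    obtain ⟨t, ht, htd⟩ := hTn m z hz
    have h1 := hM2 t ht w
    have h2 : |(∫ ω, Real.cos ⟪ω, z⟫ ∂Λ) - ∫ ω, Real.cos ⟪ω, t⟫ ∂Λ| ≤ e1 * δ m := by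
      rw [← integral_sub (hcosi z) (hcosi t)]
      refine (abs_integral_le_integral_abs).trans ?_
      rw [he1, ← integral_mul_const]
      apply integral_mono ((hcosi z).fsub (hcosi t)).abs (hni.mul_const _)
      intro a
      refine (cos_inner_lip a z t).trans ?_
      simp only
      gcongr
    have h3 : |∑ j, Real.cos ⟪w j, z⟫ - ∑ j, Real.cos ⟪w j, t⟫| ≤ (∑ j, ‖w j‖) * δ m := by
      rw [← Finset.sum_sub_distrib, Finset.sum_mul]
      refine (Finset.abs_sum_le_sum_abs _ _).trans (Finset.sum_le_sum fun j _ => ?_)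
      refine (cos_inner_lip _ z t).trans ?_
      gcongr
    have h4 : |1 / (m:ℝ) * (∑ j, Real.cos ⟪w j, z⟫ - ∑ j, Real.cos ⟪w j, t⟫)| ≤ 1 / m * ((∑ j, ‖w j‖) * δ m) := by
      rw [abs_mul, abs_of_nonneg (by positivity : (0:ℝ) ≤ 1 / m)]
      gcongr
    have h5 : (∫ ω, Real.cos ⟪ω, z⟫ ∂Λ) - (1 / m) * ∑ j, Real.cos ⟪w j, z⟫ =
      f w t + ((∫ ω, Real.cos ⟪ω, z⟫ ∂Λ) - ∫ ω, Real.cos ⟪ω, t⟫ ∂Λ)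
        - 1 / (m:ℝ) * (∑ j, Real.cos ⟪w j, z⟫ - ∑ j, Real.cos ⟪w j, t⟫) := by
      simp only [f]; ring
    rw [h5]
    have h6 := abs_sub (f w t + ((∫ ω, Real.cos ⟪ω, z⟫ ∂Λ) - ∫ ω, Real.cos ⟪ω, t⟫ ∂Λ))
      (1 / (m:ℝ) * (∑ j, Real.cos ⟪w j, z⟫ - ∑ j, Real.cos ⟪w j, t⟫))
    have h7 := abs_add_le (f w t) ((∫ ω, Real.cos ⟪ω, z⟫ ∂Λ) - ∫ ω, Real.cos ⟪ω, t⟫ ∂Λ)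
    calc _ ≤ M w + e1 * δ m + 1 / m * ((∑ j, ‖w j‖) * δ m) := by linarith
      _ = _ := by ring
  · beta_reduce
    rw [integral_add hM1 (((integrable_const _).fadd (hsi.const_mul _)).mul_const _), integral_mul_const,
      integral_add (integrable_const _) (hsi.const_mul _), integral_const_mul,
      integral_finsetSum _ (fun j _ => hji j)]
    simp only [hjI]
    simp only [integral_const, probReal_univ, one_smul, Finset.sum_const, Finset.card_univ, Fintype.card_fin,
      nsmul_eq_mul]
    have h1 : 1 / (m:ℝ) * (m * e1) = e1 := by field_simp
    rw [h1]
    have h2 : (e1 + e1) * δ m ≤ 2 * (1/2)^m := by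
      simp only [δ]
      rw [mul_div_assoc', div_le_iff₀ (by positivity)]
      have : (0:ℝ) < (1/2)^m := by positivity
      nlinarith
    have h3 : (1/2:ℝ)^m ≤ 1 / Real.sqrt m := by
      rw [one_div, inv_pow, one_div]
      apply inv_anti₀ hsm
      have h4 : (m:ℝ) ≤ 2^m := by exact_mod_cast (Nat.lt_two_pow_self (n := m)).le
      refine le_trans (Real.sqrt_le_iff.2 ⟨hm0.le, ?_⟩) h4
      have : (1:ℝ) ≤ m := by exact_mod_cast hm
      nlinarith
    have h4 : 1 / Real.sqrt m ≤ Real.sqrt d / Real.sqrt m := by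
      gcongr
      exact Real.one_le_sqrt.2 hd0
    have h5 : Real.sqrt d / Real.sqrt m * (8 * Q + 12 - (1/2)^m * (4 * Q + 2 * m + 8)) ≤
        Real.sqrt d / Real.sqrt m * (8 * Q + 12) := by
      gcongr
      have : 0 ≤ (1/2:ℝ)^m * (4 * Q + 2 * m + 8) := by positivity
      linarith
    have h6 : Real.sqrt d / Real.sqrt m * (8 * Q + 14) = Real.sqrt d / Real.sqrt m * (8 * Q + 12) +
      2 * (Real.sqrt d / Real.sqrt m) := by ring
    rw [h6]
    linarith

theorem rff_uniform_bound (d m : ℕ) (hm : 1 ≤ m)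
    (Λ : Measure (EuclideanSpace ℝ (Fin d))) [IsProbabilityMeasure Λ]
    (hσint : Integrable (fun ω : EuclideanSpace ℝ (Fin d) => ‖ω‖ ^ 2) Λ)
    (σ : ℝ) (hσ : σ = Real.sqrt (∫ ω, ‖ω‖ ^ 2 ∂Λ))
    (S : Set (EuclideanSpace ℝ (Fin d))) (hS : IsCompact S)
    (hdiam : 0 < Metric.diam S)
    (τ : ℝ) (hτ : 0 < τ) :
    1 - ENNReal.ofReal (Real.exp (-τ)) ≤
      Measure.pi (fun _ : Fin m => Λ)
        {w | (⨆ x : S, ⨆ y : S,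
            |(∫ ω, Real.cos ⟪ω, (x : EuclideanSpace ℝ (Fin d)) - y⟫ ∂Λ) -
              (1 / m) * ∑ j, Real.cos ⟪w j, (x : EuclideanSpace ℝ (Fin d)) - y⟫|) ≤
          (32 * Real.sqrt (2 * d) / Real.sqrt m) *
            (Real.sqrt (Real.log (2 * Metric.diam S + 1)) +
              1 / (2 * Real.sqrt (Real.log (2 * Metric.diam S + 1))) +
              Real.sqrt (Real.log (σ + 1))) +
          Real.sqrt (2 * τ / m)} := by
  have hm0 : (0:ℝ) < m := by exact_mod_cast hm
  have hd : 1 ≤ d := by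
    rcases Nat.eq_zero_or_pos d with rfl | h
    · exfalso
      have := Metric.diam_subsingleton (Set.subsingleton_of_subsingleton (s := S))
      linarith
    · exact h
  have hSne : Nonempty S := by
    rw [Set.nonempty_coe_sort]
    by_contra h
    rw [Set.not_nonempty_iff_eq_empty] at h
    rw [h, Metric.diam_empty] at hdiam
    exact lt_irrefl _ hdiam
  let F : S → S → (Fin m → EuclideanSpace ℝ (Fin d)) → ℝ := fun x y w =>
    |(∫ ω, Real.cos ⟪ω, (x : EuclideanSpace ℝ (Fin d)) - y⟫ ∂Λ) -
              (1 / m) * ∑ j, Real.cos ⟪w j, (x : EuclideanSpace ℝ (Fin d)) - y⟫|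
  let G : (Fin m → EuclideanSpace ℝ (Fin d)) → ℝ := fun w => ⨆ x : S, ⨆ y : S, F x y w
  have hF0 : ∀ x y w, 0 ≤ F x y w := fun x y w => abs_nonneg _
  have hF2 : ∀ x y w, F x y w ≤ 2 := by
    intro x y w
    refine (abs_sub _ _).trans ?_
    have h1 : |∫ ω, Real.cos ⟪ω, (x : EuclideanSpace ℝ (Fin d)) - y⟫ ∂Λ| ≤ 1 := by
      have := norm_integral_le_of_norm_le_const (μ := Λ)
        (f := fun ω => Real.cos ⟪ω, (x : EuclideanSpace ℝ (Fin d)) - y⟫) (C := 1)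
        (Filter.Eventually.of_forall fun v => Real.abs_cos_le_one _)
      simpa using this
    have h2 : |(1 / (m:ℝ)) * ∑ j, Real.cos ⟪w j, (x : EuclideanSpace ℝ (Fin d)) - y⟫| ≤ 1 := by
      rw [abs_mul, abs_of_nonneg (by positivity : (0:ℝ) ≤ 1 / m), one_div, inv_mul_le_iff₀ hm0]
      refine (Finset.abs_sum_le_sum_abs _ _).trans ?_
      refine (Finset.sum_le_sum fun j _ => Real.abs_cos_le_one _).trans ?_
      simp
    linarith
  have hbd : ∀ x w, BddAbove (Set.range fun y => F x y w) := fun x w =>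
    ⟨2, by rintro _ ⟨y, rfl⟩; exact hF2 x y w⟩
  have hbd2 : ∀ w, BddAbove (Set.range fun x => ⨆ y, F x y w) := fun w =>
    ⟨2, by rintro _ ⟨x, rfl⟩; exact ciSup_le fun y => hF2 x y w⟩
  have hFG : ∀ x y w, F x y w ≤ G w := fun x y w =>
    (le_ciSup (hbd x w) y).trans (le_ciSup (hbd2 w) x)
  have hGle : ∀ w B, (∀ x y, F x y w ≤ B) → G w ≤ B := fun w B h =>
    ciSup_le fun x => ciSup_le fun y => h x y
  have hGm : Measurable G := by
    apply LowerSemicontinuous.measurable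
    apply lowerSemicontinuous_ciSup hbd2
    intro x
    apply lowerSemicontinuous_ciSup (hbd x)
    intro y
    apply Continuous.lowerSemicontinuous
    simp only [F]
    fun_prop
  have hGb : ∀ w, |G w| ≤ 2 := by
    intro w
    rw [abs_of_nonneg]
    · exact hGle w 2 fun x y => hF2 x y w
    · exact (hF0 hSne.some hSne.some w).trans (hFG _ _ w)
  have hdiff1 : ∀ w w' i, (∀ j, j ≠ i → w' j = w j) → G w ≤ G w' + 2 / m := by
    intro w w' i hw
    apply hGle
    intro x y
    have h1 := hFG x y w'
    have h2 : ∑ j, Real.cos ⟪w j, (x : EuclideanSpace ℝ (Fin d)) - y⟫ -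
        ∑ j, Real.cos ⟪w' j, (x : EuclideanSpace ℝ (Fin d)) - y⟫ =
        Real.cos ⟪w i, (x : EuclideanSpace ℝ (Fin d)) - y⟫ - Real.cos ⟪w' i, (x : EuclideanSpace ℝ (Fin d)) - y⟫ := by
      rw [← Finset.sum_sub_distrib]
      apply Finset.sum_eq_single i
      · intro j _ hj
        rw [hw j hj, sub_self]
      · simp
    have h3 : |1 / (m:ℝ) * (∑ j, Real.cos ⟪w j, (x : EuclideanSpace ℝ (Fin d)) - y⟫ -
        ∑ j, Real.cos ⟪w' j, (x : EuclideanSpace ℝ (Fin d)) - y⟫)| ≤ 2 / m := by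
      rw [h2, abs_mul, abs_of_nonneg (by positivity : (0:ℝ) ≤ 1 / m), one_div, div_eq_inv_mul]
      apply mul_le_mul_of_nonneg_left _ (by positivity)
      refine (abs_sub _ _).trans ?_
      have h4 := Real.abs_cos_le_one ⟪w i, (x : EuclideanSpace ℝ (Fin d)) - y⟫
      have h5 := Real.abs_cos_le_one ⟪w' i, (x : EuclideanSpace ℝ (Fin d)) - y⟫
      linarith
    have h6 := abs_sub ((∫ ω, Real.cos ⟪ω, (x : EuclideanSpace ℝ (Fin d)) - y⟫ ∂Λ) -
        (1 / m) * ∑ j, Real.cos ⟪w' j, (x : EuclideanSpace ℝ (Fin d)) - y⟫)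
      (1 / (m:ℝ) * (∑ j, Real.cos ⟪w j, (x : EuclideanSpace ℝ (Fin d)) - y⟫ -
        ∑ j, Real.cos ⟪w' j, (x : EuclideanSpace ℝ (Fin d)) - y⟫))
    have h7 : F x y w = |(∫ ω, Real.cos ⟪ω, (x : EuclideanSpace ℝ (Fin d)) - y⟫ ∂Λ) -
        (1 / m) * ∑ j, Real.cos ⟪w' j, (x : EuclideanSpace ℝ (Fin d)) - y⟫ -
      (1 / (m:ℝ) * (∑ j, Real.cos ⟪w j, (x : EuclideanSpace ℝ (Fin d)) - y⟫ -
        ∑ j, Real.cos ⟪w' j, (x : EuclideanSpace ℝ (Fin d)) - y⟫))| := by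
      simp only [F]; congr 1; ring
    rw [h7]
    have h8 : |(∫ ω, Real.cos ⟪ω, (x : EuclideanSpace ℝ (Fin d)) - y⟫ ∂Λ) -
        (1 / m) * ∑ j, Real.cos ⟪w' j, (x : EuclideanSpace ℝ (Fin d)) - y⟫| ≤ G w' := h1
    linarith
  have hdiff : ∀ w i a, |G w - G (Function.update w i a)| ≤ 2 / m := by
    intro w i a
    have h1 := hdiff1 w (Function.update w i a) i (fun j hj => Function.update_of_ne hj _ _)
    have h2 := hdiff1 (Function.update w i a) w i (fun j hj => (Function.update_of_ne hj _ _).symm)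
    rw [abs_le]
    constructor <;> linarith
  refine mcdiarmid_tail Λ m hm G hGm 2 hGb hdiff τ hτ _ ?_
  obtain ⟨M, hM1, hM2, hM3⟩ := chain_aux d m hd hm Λ hσint σ hσ (Metric.diam S) hdiam
  have hGi : Integrable G (Measure.pi fun _ => Λ) :=
    Integrable.of_bound hGm.aestronglyMeasurable 2 (Filter.Eventually.of_forall hGb)
  have hGM : ∫ w, G w ∂(Measure.pi fun _ => Λ) ≤ ∫ w, M w ∂(Measure.pi fun _ => Λ) := by
    apply integral_mono hGi hM1
    intro w
    apply hGle
    intro x y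
    apply hM2
    rw [← dist_eq_norm]
    exact Metric.dist_le_diam_of_mem hS.isBounded x.2 y.2
  refine hGM.trans (hM3.trans ?_)
  set a := Real.sqrt (Real.log (2 * Metric.diam S + 1)) with ha
  set s := Real.sqrt (Real.log (σ + 1)) with hs
  have ha0 : 0 < a := Real.sqrt_pos.2 (Real.log_pos (by linarith))
  have hs0 : 0 ≤ s := Real.sqrt_nonneg _
  have h1 : 1 ≤ a + 1 / (2 * a) := by
    have : a + 1 / (2 * a) = (2 * a^2 + 1) / (2 * a) := by field_simp
    rw [this, le_div_iff₀ (by positivity)]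
    nlinarith [sq_nonneg (2 * a - 1)]
  have h2 : 0 ≤ 1 / (2 * a) := by positivity
  have h3 : Real.sqrt d ≤ Real.sqrt (2 * d) := by
    apply Real.sqrt_le_sqrt
    have : (0:ℝ) ≤ d := Nat.cast_nonneg d
    linarith
  calc Real.sqrt d / Real.sqrt m * (8 * (a + s) + 14)
      ≤ Real.sqrt (2 * d) / Real.sqrt m * (32 * (a + 1 / (2 * a) + s)) := by
        gcongr
        linarith
    _ = _ := by ring
end
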